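/- Let k be a field, P = k[x_1, …, x_n], ω ∈ (ℤ_{>0})^n a weight vector, and I ⊆ P a prime ideal. Then P/in_ω(I) is connected in codimension 1, i.e. c(P/in_ω(I)) ≥ dim(P/in_ω(I)) − 1. -/

import Mathlib

open TopologicalSpace

/-- The (topological Krull) dimension of a topological space, as an integer:
the supremum of the lengths of strictly increasing chains of irreducible closed subsets,
with the convention that the empty space has dimension `-1`. -/
noncomputable def topDim (T : Type*) [TopologicalSpace T] : ℤ :=
  sSup ({-1} ∪ {d : ℤ | ∃ n : ℕ, d = (n : ℤ) ∧
    ∃ c : Fin (n + 1) → IrreducibleCloseds T, StrictMono c})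

/-- The connectivity dimension `c(T)` of a topological space `T`: the minimum of `topDim Z`
over the closed subsets `Z ⊆ T` such that `T \ Z` is disconnected, the empty space counting
as disconnected (of dimension `-1`). -/
noncomputable def connDim (T : Type*) [TopologicalSpace T] : ℤ :=
  sInf {d : ℤ | ∃ Z : Set T, IsClosed Z ∧ ¬ ConnectedSpace ↥(Zᶜ) ∧ d = topDim ↥Z}

/-- The subdimension `sdim T` of a topological space: the minimum of the dimensions of its
irreducible components. -/
noncomputable def subDim (T : Type*) [TopologicalSpace T] : ℤ :=
  sInf {d : ℤ | ∃ C ∈ irreducibleComponents T, d = topDim ↥C}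

/-- The connectivity dimension `c(R)` of a commutative ring `R`, i.e. that of `Spec R`. -/
noncomputable def ringConnDim (R : Type) [CommRing R] : ℤ :=
  connDim (PrimeSpectrum R)

/-- The cohomological dimension `cd(M, a) = sup { i ∈ ℕ | H^i_a(M) ≠ 0 }` of an ideal `a`
with respect to a module `M`, where `H^i_a` is local cohomology with support in `a`. -/
noncomputable def cohDim (R : Type) [CommRing R] (a : Ideal R)
    (M : Type) [AddCommGroup M] [Module R M] : ℤ :=
  sSup {d : ℤ | ∃ i : ℕ, d = (i : ℤ) ∧
    Nontrivial ((localCohomology a i).obj (ModuleCat.of R M))}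

/-- `depth(a, M)`: the supremum of the lengths of `M`-regular sequences contained in the
ideal `a`. -/
noncomputable def idealDepth (R : Type) [CommRing R] (a : Ideal R)
    (M : Type) [AddCommGroup M] [Module R M] : ℤ :=
  sSup {d : ℤ | ∃ rs : List R, d = (rs.length : ℤ) ∧ (∀ r ∈ rs, r ∈ a) ∧
    RingTheory.Sequence.IsRegular M rs}

/-- The `ω`-degree of a polynomial: `deg_ω f = max { ω·a | x^a is a term of f }`. -/
noncomputable def wDeg {k : Type} [Field k] {n : ℕ} (ω : Fin n → ℕ)
    (f : MvPolynomial (Fin n) k) : ℕ :=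
  f.support.sup fun a => ∑ i, ω i * a i

/-- The initial form `in_ω(f)`: the sum of the terms of `f` of maximal `ω`-degree. -/
noncomputable def initialForm {k : Type} [Field k] {n : ℕ} (ω : Fin n → ℕ)
    (f : MvPolynomial (Fin n) k) : MvPolynomial (Fin n) k :=
  ∑ a ∈ f.support.filter (fun a => ∑ i, ω i * a i = wDeg ω f),
    MvPolynomial.monomial a (f.coeff a)

/-- The initial ideal `in_ω(I)` of an ideal `I`, generated by the initial forms of its
nonzero elements. -/
noncomputable def initialIdeal {k : Type} [Field k] {n : ℕ} (ω : Fin n → ℕ)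
    (I : Ideal (MvPolynomial (Fin n) k)) : Ideal (MvPolynomial (Fin n) k) :=
  Ideal.span {g | ∃ f ∈ I, f ≠ 0 ∧ g = initialForm ω f}


open Polynomial in
theorem core_exists {A R : Type*} [CommRing A] [IsDomain A]
    [CommRing R] [Algebra A[X] R] {ι : Type*}
    (p0 : A) (p : ι → A) (a b : R) (a' b' : ι → R) (hp0 : p0 ≠ 0)
    (hi : ∀ i, algebraMap A[X] R (C (p i)) = a' i + b' i)
    (hab : algebraMap A[X] R X ∣ a * b)
    (hab1 : ∀ i, algebraMap A[X] R X ∣ a * b' i)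
    (hab2 : ∀ i, algebraMap A[X] R X ∣ a' i * b)
    (hcop : ∀ (m : ℕ) (u : A), (∀ i, p0 ^ m ∣ (p i) ^ m * u) → p0 ^ m ∣ u)
    (α β : ℕ → R) (hαβ : ∀ n, algebraMap A[X] R (C (p0 ^ (2 * n))) = α n + β n)
    (hα : ∀ n, a ^ n ∣ α n) (hβ : ∀ n, b ^ n ∣ β n)
    (φ : R →ₗ[A[X]] A[X])
    (hdeg : ∀ r, ∃ B : ℕ, ∀ n j, B < j → j < n → ∀ w, p0 ^ (2 * n) * w = (φ (r * α n)).coeff j →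
      w = 0) (r : R) :
    ∃ s : A[X], ∀ n, X ^ n ∣ C (p0 ^ (2 * n)) * s - φ (r * α n) := by
  have key : ∀ (c : R) (n : ℕ), (algebraMap A[X] R X) ^ n ∣ c → X ^ n ∣ φ c := by
    rintro c n ⟨x, rfl⟩
    rw [← map_pow, ← Algebra.smul_def, map_smul, smul_eq_mul]
    exact dvd_mul_right _ _
  have hsm : ∀ (s : A[X]) (c : R), φ (algebraMap A[X] R s * c) = s * φ c := by
    intro s c
    rw [← Algebra.smul_def, map_smul, smul_eq_mul]
  have hpd : ∀ {x y : R} (n : ℕ) {z w : R}, algebraMap A[X] R X ∣ x * y → x ^ n ∣ z → y ^ n ∣ w →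
      (algebraMap A[X] R X) ^ n ∣ z * w := by
    intro x y n z w h h1 h2
    refine dvd_trans (pow_dvd_pow_of_dvd h n) ?_
    rw [mul_pow]
    exact mul_dvd_mul h1 h2
  have hdiv : ∀ n j, j < n → p0 ^ (2 * n) ∣ (φ (r * α n)).coeff j := by
    intro n j hj
    apply hcop
    intro i
    obtain ⟨x, y, hxy, hx, hy⟩ : ∃ x y, (a' i + b' i) ^ (2 * n) = x + y ∧ (a' i) ^ n ∣ x ∧
        (b' i) ^ n ∣ y := by
      have : (a' i + b' i) ^ (2 * n) ∈ Ideal.span {(a' i) ^ n} ⊔ Ideal.span {(b' i) ^ n} := by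
        apply Ideal.add_pow_mem_of_pow_mem_of_le (m := n) (n := n)
        · exact Ideal.mem_sup_left (Ideal.mem_span_singleton_self _)
        · exact Ideal.mem_sup_right (Ideal.mem_span_singleton_self _)
        · omega
      obtain ⟨x, hx, y, hy, h⟩ := Submodule.mem_sup.1 this
      exact ⟨x, y, h.symm, Ideal.mem_span_singleton.1 hx, Ideal.mem_span_singleton.1 hy⟩
    have h1 : (algebraMap A[X] R X) ^ n ∣
        r * (algebraMap A[X] R (C (p i ^ (2 * n))) * α n - algebraMap A[X] R (C (p0 ^ (2 * n))) * x) := by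
      have e : algebraMap A[X] R (C (p i ^ (2 * n))) = x + y := by
        rw [map_pow, map_pow, hi, hxy]
      rw [e, hαβ n]
      have : (x + y) * α n - (α n + β n) * x = α n * y - x * β n := by ring
      rw [this]
      exact dvd_mul_of_dvd_right (dvd_sub (hpd n (hab1 i) (hα n) hy) (hpd n (hab2 i) hx (hβ n))) _
    have h2 := key _ _ h1
    have h3 : φ (r * (algebraMap A[X] R (C (p i ^ (2 * n))) * α n
        - algebraMap A[X] R (C (p0 ^ (2 * n))) * x))
        = C (p i ^ (2 * n)) * φ (r * α n) - C (p0 ^ (2 * n)) * φ (r * x) := by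
      rw [← hsm, ← hsm, ← map_sub]; congr 1; ring
    rw [h3, X_pow_dvd_iff] at h2
    have h4 := h2 j hj
    rw [coeff_sub, coeff_C_mul, coeff_C_mul, sub_eq_zero] at h4
    rw [h4]; exact dvd_mul_right _ _
  choose! w hw using hdiv
  obtain ⟨B, hB⟩ := hdeg r
  have hind : ∀ n m j, j < n → j < m → w n j = w m j := by
    intro n m j hn hm
    have h1 : (algebraMap A[X] R X) ^ (j + 1) ∣
        r * (algebraMap A[X] R (C (p0 ^ (2 * m))) * α n
          - algebraMap A[X] R (C (p0 ^ (2 * n))) * α m) := by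
      rw [hαβ n, hαβ m]
      have : (α m + β m) * α n - (α n + β n) * α m = α n * β m - α m * β n := by ring
      rw [this]
      refine dvd_mul_of_dvd_right (dvd_sub (hpd _ hab ?_ ?_) (hpd _ hab ?_ ?_)) _
      · exact (pow_dvd_pow _ hn).trans (hα n)
      · exact (pow_dvd_pow _ hm).trans (hβ m)
      · exact (pow_dvd_pow _ hm).trans (hα m)
      · exact (pow_dvd_pow _ hn).trans (hβ n)
    have h2 := key _ _ h1
    have h3 : φ (r * (algebraMap A[X] R (C (p0 ^ (2 * m))) * α n
        - algebraMap A[X] R (C (p0 ^ (2 * n))) * α m))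
        = C (p0 ^ (2 * m)) * φ (r * α n) - C (p0 ^ (2 * n)) * φ (r * α m) := by
      rw [← hsm, ← hsm, ← map_sub]; congr 1; ring
    rw [h3, X_pow_dvd_iff] at h2
    have h4 := h2 j (by omega)
    rw [coeff_sub, coeff_C_mul, coeff_C_mul, sub_eq_zero, hw n j hn, hw m j hm] at h4
    have h5 : p0 ^ (2 * m) * p0 ^ (2 * n) ≠ 0 := mul_ne_zero (pow_ne_zero _ hp0) (pow_ne_zero _ hp0)
    apply mul_left_cancel₀ h5
    linear_combination h4
  refine ⟨∑ j ∈ Finset.range (B + 1), monomial j (w (j + 1) j), fun n => ?_⟩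
  rw [X_pow_dvd_iff]
  intro j hj
  rw [coeff_sub, coeff_C_mul, finset_sum_coeff, sub_eq_zero]
  simp only [coeff_monomial, Finset.sum_ite_eq', Finset.mem_range]
  split_ifs with h
  · rw [hw n j hj, hind (j + 1) n j (by omega) hj]
  · have := hB n j (by omega) hj (w n j) (hw n j hj).symm
    rw [hw n j hj, this]

open Polynomial in
theorem core {A R : Type*} [CommRing A] [IsDomain A] [IsNoetherianRing A]
    [CommRing R] [IsDomain R] [Algebra A[X] R] [Module.Finite A[X] R] {ι : Type*}
    (p0 : A) (p : ι → A) (a b : R) (a' b' : ι → R) (hp0 : p0 ≠ 0)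
    (hi : ∀ i, algebraMap A[X] R (C (p i)) = a' i + b' i)
    (hab : algebraMap A[X] R X ∣ a * b)
    (hab1 : ∀ i, algebraMap A[X] R X ∣ a * b' i)
    (hab2 : ∀ i, algebraMap A[X] R X ∣ a' i * b)
    (hcop : ∀ (m : ℕ) (u : A), (∀ i, p0 ^ m ∣ (p i) ^ m * u) → p0 ^ m ∣ u)
    (α β : ℕ → R) (hαβ : ∀ n, algebraMap A[X] R (C (p0 ^ (2 * n))) = α n + β n)
    (hα : ∀ n, a ^ n ∣ α n) (hβ : ∀ n, b ^ n ∣ β n)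
    (φ : R →ₗ[A[X]] A[X]) (hφ : φ ≠ 0)
    (hdeg : ∀ r, ∃ B : ℕ, ∀ n j, B < j → j < n → ∀ w, p0 ^ (2 * n) * w = (φ (r * α n)).coeff j →
      w = 0) :
    (∀ c, algebraMap A[X] R X ∣ c * b → ∃ m, algebraMap A[X] R X ∣ c ^ m) ∨
    (∀ c, algebraMap A[X] R X ∣ c * a → ∃ m, algebraMap A[X] R X ∣ c ^ m) := by
  have key : ∀ (φ : R →ₗ[A[X]] A[X]) (c : R) (n : ℕ), (algebraMap A[X] R X) ^ n ∣ c → X ^ n ∣ φ c := by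
    rintro φ c n ⟨x, rfl⟩
    rw [← map_pow, ← Algebra.smul_def, map_smul, smul_eq_mul]
    exact dvd_mul_right _ _
  have hsm : ∀ (φ : R →ₗ[A[X]] A[X]) (s : A[X]) (c : R),
      φ (algebraMap A[X] R s * c) = s * φ c := by
    intro φ s c
    rw [← Algebra.smul_def, map_smul, smul_eq_mul]
  have hpd : ∀ {x y : R} (n : ℕ) {z w : R}, algebraMap A[X] R X ∣ x * y → x ^ n ∣ z → y ^ n ∣ w →
      (algebraMap A[X] R X) ^ n ∣ z * w := by
    intro x y n z w h h1 h2
    refine dvd_trans (pow_dvd_pow_of_dvd h n) ?_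
    rw [mul_pow]
    exact mul_dvd_mul h1 h2
  have hcan : ∀ (n m : ℕ) (s : A[X]), X ^ n ∣ C (p0 ^ m) * s → X ^ n ∣ s := by
    intro n m s h
    rw [X_pow_dvd_iff] at h ⊢
    intro j hj
    have := h j hj
    rw [coeff_C_mul] at this
    exact (mul_eq_zero.1 this).resolve_left (pow_ne_zero _ hp0)
  have hsep : ∀ s : A[X], (∀ n, X ^ n ∣ s) → s = 0 := by
    intro s h
    ext j
    exact (X_pow_dvd_iff.1 (h (j + 1))) j (by omega)
  -- construct φ'
  choose e he using core_exists p0 p a b a' b' hp0 hi hab hab1 hab2 hcop α β hαβ hα hβ φ hdeg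
  have heu : ∀ r s, (∀ n, X ^ n ∣ C (p0 ^ (2 * n)) * s - φ (r * α n)) → s = e r := by
    intro r s h
    rw [← sub_eq_zero]
    apply hsep
    intro n
    apply hcan n (2 * n)
    have := dvd_sub (h n) (he r n)
    convert this using 1
    ring
  let φ' : R →ₗ[A[X]] A[X] :=
    { toFun := e
      map_add' := by
        intro x y
        symm
        apply heu
        intro n
        have := dvd_add (he x n) (he y n)
        convert this using 1
        rw [add_mul, map_add]; ring
      map_smul' := by
        intro s x
        symm
        apply heu
        intro n
        have := Dvd.dvd.mul_left (he x n) s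
        convert this using 1
        simp only [RingHom.id_apply, smul_eq_mul]
        rw [smul_mul_assoc, map_smul, smul_eq_mul]; ring }
  have hφ' : ∀ r n, X ^ n ∣ C (p0 ^ (2 * n)) * φ' r - φ (r * α n) := he
  have h1 : ∀ r n, X ^ n ∣ C (p0 ^ (2 * n)) * φ' r - φ' (r * α n) := by
    intro r n
    apply hcan n (2 * n)
    have e1 := Dvd.dvd.mul_left (hφ' r n) (C (p0 ^ (2 * n)))
    have e2 := hφ' (r * α n) n
    have e3 : X ^ n ∣ φ (r * (α n * β n)) :=
      key _ _ _ (dvd_mul_of_dvd_right (hpd n hab (hα n) (hβ n)) _)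
    have e4 : φ (r * α n * α n) = C (p0 ^ (2 * n)) * φ (r * α n) - φ (r * (α n * β n)) := by
      rw [← hsm, ← map_sub, hαβ]; congr 1; ring
    rw [e4] at e2
    have := dvd_sub (dvd_sub e1 e2) (dvd_neg.2 e3)
    convert this using 1
    ring
  have final : ∀ (ψ : R →ₗ[A[X]] A[X]), ψ ≠ 0 → ∀ (x y : R) (γ δ : ℕ → R),
      (∀ n, algebraMap A[X] R (C (p0 ^ (2 * n))) = γ n + δ n) →
      (∀ n, y ^ n ∣ δ n) → (∀ r n, X ^ n ∣ ψ (r * γ n)) →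
      ∀ c, algebraMap A[X] R X ∣ c * y → ∃ m, algebraMap A[X] R X ∣ c ^ m := by
    intro ψ hψ x y γ δ hγδ hδ hψγ c hc
    have f1 : ∀ r n, X ^ n ∣ ψ (r * c ^ n) := by
      intro r n
      apply hcan n (2 * n)
      rw [← hsm, hγδ]
      have : (γ n + δ n) * (r * c ^ n) = (r * c ^ n) * γ n + r * (c ^ n * δ n) := by ring
      rw [this, map_add]
      exact dvd_add (hψγ _ _) (key _ _ _ (dvd_mul_of_dvd_right (hpd n hc dvd_rfl (hδ n)) _))
    choose g hg using f1
    -- ψ_n = (c/t)^n ψ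
    let Ψ : ℕ → (R →ₗ[A[X]] A[X]) := fun n =>
      { toFun := fun r => g r n
        map_add' := by
          intro u v
          apply mul_left_cancel₀ (pow_ne_zero n (X_ne_zero (R := A)))
          rw [mul_add, ← hg, ← hg, ← hg, add_mul, map_add]
        map_smul' := by
          intro s u
          apply mul_left_cancel₀ (pow_ne_zero n (X_ne_zero (R := A)))
          simp only [RingHom.id_apply, smul_eq_mul]
          rw [← hg, smul_mul_assoc, map_smul, smul_eq_mul, hg]; ring }
    have hΨ : ∀ n r, X ^ n * Ψ n r = ψ (r * c ^ n) := fun n r => (hg r n).symm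
    have hN : IsNoetherian A[X] (R →ₗ[A[X]] A[X]) := inferInstance
    let W : ℕ →o Submodule A[X] (R →ₗ[A[X]] A[X]) :=
      ⟨fun n => Submodule.span _ (Ψ '' (Set.Iio n)), fun i j hij =>
        Submodule.span_mono (Set.image_mono (Set.Iio_subset_Iio hij))⟩
    obtain ⟨m, hm⟩ := monotone_stabilizes_iff_noetherian.2 hN W
    have hmem : Ψ m ∈ W m := by
      rw [hm (m + 1) (by omega)]
      exact Submodule.subset_span ⟨m, by simp, rfl⟩
    -- conclude
    have hWm : ∀ θ ∈ W m, ∃ d : R, algebraMap A[X] R X ∣ d ∧ ∀ r, X ^ m * θ r = ψ (r * d) := by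
      intro θ hθ
      induction hθ using Submodule.span_induction with
      | mem θ h =>
        obtain ⟨i, hi, rfl⟩ := h
        have hi' : i < m := hi
        refine ⟨(algebraMap A[X] R X) ^ (m - i) * c ^ i,
          dvd_mul_of_dvd_left (dvd_pow_self _ (by omega)) _, fun r => ?_⟩
        have : r * ((algebraMap A[X] R X) ^ (m - i) * c ^ i) =
          algebraMap A[X] R (X ^ (m - i)) * (r * c ^ i) := by rw [map_pow]; ring
        rw [this, hsm, ← hΨ, ← mul_assoc, ← pow_add]
        congr 2; omega
      | zero => exact ⟨0, dvd_zero _, by simp⟩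
      | add θ₁ θ₂ _ _ h₁ h₂ =>
        obtain ⟨d₁, k₁, l₁⟩ := h₁
        obtain ⟨d₂, k₂, l₂⟩ := h₂
        refine ⟨d₁ + d₂, dvd_add k₁ k₂, fun r => ?_⟩
        rw [LinearMap.add_apply, mul_add, l₁, l₂, mul_add, map_add]
      | smul s θ _ h =>
        obtain ⟨d, k, l⟩ := h
        refine ⟨algebraMap A[X] R s * d, dvd_mul_of_dvd_right k _, fun r => ?_⟩
        have : r * (algebraMap A[X] R s * d) = algebraMap A[X] R s * (r * d) := by ring
        rw [this, hsm, ← l, LinearMap.smul_apply, smul_eq_mul]; ring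
    obtain ⟨d, hd1, hd2⟩ := hWm _ hmem
    have hz : ∀ r, ψ (r * (c ^ m - d)) = 0 := by
      intro r
      rw [mul_sub, map_sub, ← hd2, hΨ, sub_self]
    have hcd : c ^ m - d = 0 := by
      by_contra hne
      apply hψ
      -- torsion: nonzero element of R divides nonzero element of A[X]
      have halg : Algebra.IsIntegral A[X] R := inferInstance
      obtain ⟨q, hq0, hq⟩ : ∃ q : A[X], algebraMap A[X] R q ≠ 0 ∧ (c ^ m - d) ∣ algebraMap A[X] R q := by
        obtain ⟨P, hP1, hP2⟩ := halg.isIntegral (c ^ m - d)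
        clear_value Ψ W
        have : ∀ N (P : A[X][X]), P.natDegree ≤ N → P.map (algebraMap A[X] R) ≠ 0 →
            P.eval₂ (algebraMap A[X] R) (c ^ m - d) = 0 →
            ∃ q : A[X], algebraMap A[X] R q ≠ 0 ∧ (c ^ m - d) ∣ algebraMap A[X] R q := by
          intro N
          induction N with
          | zero =>
            intro P hN hP h0
            rw [Polynomial.eq_C_of_natDegree_le_zero hN] at hP h0
            rw [eval₂_C] at h0
            rw [map_C, h0] at hP
            simp at hP
          | succ N ih =>
            intro P hN hP h0
            by_cases hc0 : algebraMap A[X] R (P.coeff 0) = 0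
            · apply ih P.divX
              · rw [natDegree_divX_eq_natDegree_tsub_one]; omega
              · intro h
                apply hP
                rw [← divX_mul_X_add P, Polynomial.map_add, Polynomial.map_mul, h]
                simp [hc0]
              · rw [← divX_mul_X_add P, eval₂_add, eval₂_mul, eval₂_C, hc0, eval₂_X, add_zero] at h0
                exact (mul_eq_zero.1 h0).resolve_right hne
            · refine ⟨P.coeff 0, hc0, ?_⟩
              rw [← divX_mul_X_add P, eval₂_add, eval₂_mul, eval₂_C, eval₂_X] at h0
              rw [eq_neg_of_add_eq_zero_right h0]
              exact (dvd_mul_left _ _).neg_right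
        exact this _ P le_rfl (hP1.map _).ne_zero hP2
      ext1 r
      obtain ⟨q', hq'⟩ := hq
      have h0 : ψ (algebraMap A[X] R q * r) = 0 := by
        rw [hq']
        have := hz (q' * r)
        rw [← this]; congr 1; ring
      rw [hsm] at h0
      rcases mul_eq_zero.1 h0 with h | h
      · rw [h, map_zero] at hq0; exact absurd rfl hq0
      · exact h
    exact ⟨m, by rw [sub_eq_zero.1 hcd]; exact hd1⟩
  by_cases hz : φ' = 0
  · left
    refine final φ hφ a b α β hαβ hβ ?_
    intro r n
    have := hφ' r n
    rw [hz] at this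
    simpa using this
  · right
    refine final φ' hz b a β α (fun n => by rw [hαβ, add_comm]) hα ?_
    intro r n
    have := h1 r n
    rw [← hsm, ← map_sub, hαβ] at this
    convert this using 2
    ring


section part2
open MvPolynomial

/-- polynomials all of whose monomials have weight at most `l` -/
noncomputable def wle (k : Type) [Field k] {n : ℕ} (ω : Fin n → ℕ) (l : ℕ) :
    Submodule k (MvPolynomial (Fin n) k) where
  carrier := {h | ∀ m, coeff m h ≠ 0 → Finsupp.weight ω m ≤ l}
  zero_mem' := by intro m h; simp at h
  add_mem' := by
    intro a b ha hb m h
    by_cases h1 : coeff m a = 0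
    · apply hb; intro h2; apply h; rw [coeff_add, h1, h2, add_zero]
    · exact ha m h1
  smul_mem' := by
    intro c a ha m h
    apply ha; intro h2; apply h; rw [coeff_smul, h2, smul_zero]

theorem mem_wle {k : Type} [Field k] {n : ℕ} {ω : Fin n → ℕ} {l : ℕ} {h : MvPolynomial (Fin n) k} :
    h ∈ wle k ω l ↔ ∀ m, coeff m h ≠ 0 → Finsupp.weight ω m ≤ l := Iff.rfl

theorem wle_mul {k : Type} [Field k] {n : ℕ} {ω : Fin n → ℕ} {l l' : ℕ}
    {h h' : MvPolynomial (Fin n) k} (hh : h ∈ wle k ω l) (hh' : h' ∈ wle k ω l') :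
    h * h' ∈ wle k ω (l + l') := by
  classical
  intro m hm
  rw [coeff_mul] at hm
  obtain ⟨x, hx, hx0⟩ := Finset.exists_ne_zero_of_sum_ne_zero hm
  rw [Finset.HasAntidiagonal.mem_antidiagonal] at hx
  rw [← hx, map_add]
  exact add_le_add (hh _ (left_ne_zero_of_mul hx0)) (hh' _ (right_ne_zero_of_mul hx0))

theorem wle_mono {k : Type} [Field k] {n : ℕ} {ω : Fin n → ℕ} {l l' : ℕ} (h : l ≤ l') :
    wle k ω l ≤ wle k ω l' := fun _ hh m hm => (hh m hm).trans h

theorem whom_mem_wle {k : Type} [Field k] {n : ℕ} {ω : Fin n → ℕ} {l : ℕ}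
    {h : MvPolynomial (Fin n) k} (hh : IsWeightedHomogeneous ω h l) : h ∈ wle k ω l :=
  fun _ hm => (hh hm).le

theorem weight_eq_sum {n : ℕ} (ω : Fin n → ℕ) (a : Fin n →₀ ℕ) :
    Finsupp.weight ω a = ∑ i, ω i * a i := by
  rw [Finsupp.weight_apply, Finsupp.sum_fintype _ _ (by simp)]
  simp [mul_comm]

theorem initialForm_eq {k : Type} [Field k] {n : ℕ} (ω : Fin n → ℕ)
    (f : MvPolynomial (Fin n) k) :
    initialForm ω f = weightedHomogeneousComponent ω (wDeg ω f) f := by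
  classical
  rw [weightedHomogeneousComponent_apply, initialForm]
  simp only [weight_eq_sum]

theorem mem_wle_wDeg {k : Type} [Field k] {n : ℕ} (ω : Fin n → ℕ)
    (f : MvPolynomial (Fin n) k) : f ∈ wle k ω (wDeg ω f) := by
  intro m hm
  rw [weight_eq_sum]
  exact Finset.le_sup (f := fun a : Fin n →₀ ℕ => ∑ i, ω i * a i) (mem_support_iff.2 hm)

theorem initialIdeal_homog {k : Type} [Field k] {n : ℕ} (ω : Fin n → ℕ)
    (I : Ideal (MvPolynomial (Fin n) k)) :
    letI := weightedGradedAlgebra k ω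
    (initialIdeal ω I).IsHomogeneous (weightedHomogeneousSubmodule k ω) := by
  letI := weightedGradedAlgebra k ω
  apply Ideal.homogeneous_span
  rintro g ⟨f, -, -, rfl⟩
  rw [initialForm_eq]
  exact ⟨_, weightedHomogeneousComponent_mem _ _ _⟩

/-- ideals closed under homogeneous components -/
def HomogI {k : Type} [Field k] {n : ℕ} (ω : Fin n → ℕ) (J : Ideal (MvPolynomial (Fin n) k)) : Prop :=
  ∀ f ∈ J, ∀ l, weightedHomogeneousComponent ω l f ∈ J

theorem homogI_iff {k : Type} [Field k] {n : ℕ} (ω : Fin n → ℕ) (J : Ideal (MvPolynomial (Fin n) k)) :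
    letI := weightedGradedAlgebra k ω
    J.IsHomogeneous (weightedHomogeneousSubmodule k ω) ↔ HomogI ω J := by
  letI := weightedGradedAlgebra k ω
  have : ∀ (i : ℕ) (f : MvPolynomial (Fin n) k),
      ((DirectSum.decompose (weightedHomogeneousSubmodule k ω) f) i : MvPolynomial (Fin n) k)
      = weightedHomogeneousComponent ω i f := by
    intro i f
    exact weightedDecomposition.decompose'_apply k ω f i
  constructor
  · intro h f hf l
    rw [← this]; exact h l hf
  · intro h l f hf
    rw [this]; exact h f hf l

theorem sum_whc {k : Type} [Field k] {n : ℕ} (ω : Fin n → ℕ) (f : MvPolynomial (Fin n) k) (B : ℕ)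
    (hB : f ∈ wle k ω B) : f = ∑ l ∈ Finset.range (B + 1), weightedHomogeneousComponent ω l f := by
  classical
  ext m
  rw [coeff_sum]
  simp only [coeff_weightedHomogeneousComponent, Finset.sum_ite_eq, Finset.mem_range]
  split_ifs with h
  · rfl
  · by_contra h1
    exact h (Nat.lt_succ_of_le (hB m h1))

theorem initial_char_mpr {k : Type} [Field k] {n : ℕ} (ω : Fin n → ℕ)
    (I : Ideal (MvPolynomial (Fin n) k)) (c h : MvPolynomial (Fin n) k) (e : ℕ)
    (hc : IsWeightedHomogeneous ω c e) (hh : ∀ m, coeff m h ≠ 0 → Finsupp.weight ω m < e)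
    (hI : c - h ∈ I) : c ∈ initialIdeal ω I := by
  classical
  by_cases hc0 : c = 0
  · rw [hc0]; exact Ideal.zero_mem _
  have hcomp : weightedHomogeneousComponent ω e (c - h) = c := by
    rw [map_sub, hc.weightedHomogeneousComponent_same, weightedHomogeneousComponent_eq_zero', sub_zero]
    intro m hm
    exact (hh m (mem_support_iff.1 hm)).ne
  have hne : c - h ≠ 0 := by
    intro h0; rw [h0, map_zero] at hcomp; exact hc0 hcomp.symm
  have hdeg : wDeg ω (c - h) = e := by
    apply le_antisymm
    · apply Finset.sup_le
      intro m hm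
      rw [← weight_eq_sum]
      rw [mem_support_iff, coeff_sub] at hm
      by_cases h1 : coeff m h = 0
      · rw [h1, sub_zero] at hm; exact (hc hm).le
      · exact (hh m h1).le
    · obtain ⟨m, hm⟩ := exists_coeff_ne_zero hc0
      rw [← hc hm]
      apply mem_wle_wDeg ω (c - h) m
      rw [coeff_sub]
      have : coeff m h = 0 := by
        by_contra h1
        have := hh m h1
        rw [hc hm] at this; exact lt_irrefl _ this
      rw [this, sub_zero]; exact hm
  apply Ideal.subset_span
  refine ⟨c - h, hI, hne, ?_⟩
  rw [initialForm_eq, hdeg, hcomp]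

theorem whc_monomial_mul {k : Type} [Field k] {n : ℕ} (ω : Fin n → ℕ) (u : Fin n →₀ ℕ) (a : k)
    (f : MvPolynomial (Fin n) k) (e : ℕ) :
    weightedHomogeneousComponent ω e (monomial u a * f) =
      if Finsupp.weight ω u ≤ e then
        monomial u a * weightedHomogeneousComponent ω (e - Finsupp.weight ω u) f else 0 := by
  classical
  ext m
  rw [coeff_weightedHomogeneousComponent, coeff_monomial_mul']
  by_cases hum : u ≤ m
  · obtain ⟨v, rfl⟩ := exists_add_of_le hum
    simp only [le_add_iff_nonneg_right, zero_le, if_true, add_tsub_cancel_left, map_add]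
    split_ifs with h1 h2 h2
    · rw [coeff_monomial_mul, coeff_weightedHomogeneousComponent, if_pos (by omega)]
    · omega
    · rw [coeff_monomial_mul, coeff_weightedHomogeneousComponent, if_neg (by omega), mul_zero]
    · simp
  · rw [if_neg hum, ite_self]
    split_ifs
    · rw [coeff_monomial_mul', if_neg hum]
    · simp

theorem initial_char_mp {k : Type} [Field k] {n : ℕ} (ω : Fin n → ℕ)
    (I : Ideal (MvPolynomial (Fin n) k)) (c : MvPolynomial (Fin n) k) (hcJ : c ∈ initialIdeal ω I)
    (e : ℕ) : ∃ h, (∀ m, coeff m h ≠ 0 → Finsupp.weight ω m < e) ∧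
      weightedHomogeneousComponent ω e c - h ∈ I := by
  classical
  induction hcJ using Submodule.span_induction generalizing e with
  | mem x hx =>
    obtain ⟨f, hf, -, rfl⟩ := hx
    rw [initialForm_eq]
    by_cases he : e = wDeg ω f
    · subst he
      refine ⟨weightedHomogeneousComponent ω (wDeg ω f) f - f, ?_, ?_⟩
      · intro m hm
        rw [coeff_sub, coeff_weightedHomogeneousComponent] at hm
        split_ifs at hm with h1
        · simp at hm
        · rw [zero_sub, neg_ne_zero] at hm
          exact lt_of_le_of_ne (mem_wle_wDeg ω f m hm) h1
      · rw [(weightedHomogeneousComponent_isWeightedHomogeneous _ _).weightedHomogeneousComponent_same]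
        simpa using hf
    · refine ⟨0, by simp, ?_⟩
      rw [(weightedHomogeneousComponent_isWeightedHomogeneous _ _).weightedHomogeneousComponent_ne _ he]
      simp
  | zero => exact ⟨0, by simp, by simp⟩
  | add x y _ _ hx hy =>
    obtain ⟨h₁, a₁, b₁⟩ := hx e
    obtain ⟨h₂, a₂, b₂⟩ := hy e
    refine ⟨h₁ + h₂, ?_, ?_⟩
    · intro m hm
      by_cases h1 : coeff m h₁ = 0
      · apply a₂; intro h2; apply hm; rw [coeff_add, h1, h2, add_zero]
      · exact a₁ m h1
    · rw [map_add]
      convert I.add_mem b₁ b₂ using 1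
      ring
  | smul q x _ hx =>
    rw [smul_eq_mul]
    induction q using MvPolynomial.induction_on' generalizing e with
    | monomial u a =>
      rw [whc_monomial_mul]
      split_ifs with hu
      · obtain ⟨h, h1, h2⟩ := hx (e - Finsupp.weight ω u)
        refine ⟨monomial u a * h, ?_, ?_⟩
        · intro m hm
          rw [coeff_monomial_mul'] at hm
          split_ifs at hm with hum
          · have := h1 _ (right_ne_zero_of_mul hm)
            obtain ⟨v, rfl⟩ := exists_add_of_le hum
            rw [add_tsub_cancel_left] at this
            rw [map_add]; omega
          · exact absurd rfl hm
        · rw [← mul_sub]; exact I.mul_mem_left _ h2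
      · exact ⟨0, by simp, by simp⟩
    | add p q hp hq =>
      obtain ⟨h₁, a₁, b₁⟩ := hp e
      obtain ⟨h₂, a₂, b₂⟩ := hq e
      refine ⟨h₁ + h₂, ?_, ?_⟩
      · intro m hm
        by_cases h1 : coeff m h₁ = 0
        · apply a₂; intro h2; apply hm; rw [coeff_add, h1, h2, add_zero]
        · exact a₁ m h1
      · rw [add_mul, map_add]
        convert I.add_mem b₁ b₂ using 1
        ring

/-- the filtration on the quotient -/
noncomputable def Fil {k : Type} [Field k] {n : ℕ} (ω : Fin n → ℕ)
    (I : Ideal (MvPolynomial (Fin n) k)) (l : ℕ) : Submodule k (MvPolynomial (Fin n) k ⧸ I) :=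
  (wle k ω l).map (Ideal.Quotient.mkₐ k I).toLinearMap

theorem Fil_mul {k : Type} [Field k] {n : ℕ} {ω : Fin n → ℕ}
    {I : Ideal (MvPolynomial (Fin n) k)} {l l' : ℕ} {x y : MvPolynomial (Fin n) k ⧸ I}
    (hx : x ∈ Fil ω I l) (hy : y ∈ Fil ω I l') : x * y ∈ Fil ω I (l + l') := by
  obtain ⟨a, ha, rfl⟩ := hx
  obtain ⟨b, hb, rfl⟩ := hy
  exact ⟨a * b, wle_mul ha hb, by simp⟩

theorem mk_mem_Fil {k : Type} [Field k] {n : ℕ} {ω : Fin n → ℕ}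
    {I : Ideal (MvPolynomial (Fin n) k)} {l : ℕ} {h : MvPolynomial (Fin n) k} (hh : h ∈ wle k ω l) :
    Ideal.Quotient.mk I h ∈ Fil ω I l := ⟨h, hh, rfl⟩

theorem one_mem_Fil {k : Type} [Field k] {n : ℕ} {ω : Fin n → ℕ}
    {I : Ideal (MvPolynomial (Fin n) k)} : (1 : MvPolynomial (Fin n) k ⧸ I) ∈ Fil ω I 0 := by
  rw [← map_one (Ideal.Quotient.mk I)]
  exact mk_mem_Fil (whom_mem_wle (isWeightedHomogeneous_one k ω))

theorem Fil_mono {k : Type} [Field k] {n : ℕ} {ω : Fin n → ℕ}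
    {I : Ideal (MvPolynomial (Fin n) k)} {l l' : ℕ} (h : l ≤ l') : Fil ω I l ≤ Fil ω I l' :=
  Submodule.map_mono (wle_mono h)

/-- the (extended) Rees ring -/
noncomputable def Rees {k : Type} [Field k] {n : ℕ} (ω : Fin n → ℕ)
    (I : Ideal (MvPolynomial (Fin n) k)) : Subring (Polynomial (MvPolynomial (Fin n) k ⧸ I)) where
  carrier := {r | ∀ l, r.coeff l ∈ Fil ω I l}
  zero_mem' := by intro l; simp
  add_mem' := by intro a b ha hb l; rw [Polynomial.coeff_add]; exact add_mem (ha l) (hb l)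
  neg_mem' := by intro a ha l; rw [Polynomial.coeff_neg]; exact neg_mem (ha l)
  one_mem' := by
    intro l
    rw [Polynomial.coeff_one]
    split_ifs with h
    · exact Fil_mono (Nat.zero_le _) one_mem_Fil
    · exact zero_mem _
  mul_mem' := by
    intro a b ha hb l
    rw [Polynomial.coeff_mul]
    apply sum_mem
    intro x hx
    rw [← Finset.HasAntidiagonal.mem_antidiagonal.1 hx]
    exact Fil_mul (ha _) (hb _)

theorem monomial_mem_Rees {k : Type} [Field k] {n : ℕ} {ω : Fin n → ℕ}
    {I : Ideal (MvPolynomial (Fin n) k)} {l : ℕ} {x : MvPolynomial (Fin n) k ⧸ I}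
    (hx : x ∈ Fil ω I l) : Polynomial.monomial l x ∈ Rees ω I := by
  intro j
  rw [Polynomial.coeff_monomial]
  split_ifs with h
  · rw [← h]; exact hx
  · exact zero_mem _

theorem X_mem_Rees {k : Type} [Field k] {n : ℕ} {ω : Fin n → ℕ}
    {I : Ideal (MvPolynomial (Fin n) k)} : Polynomial.X ∈ Rees ω I :=
  monomial_mem_Rees (Fil_mono (Nat.zero_le _) one_mem_Fil)

/-- initial ideal membership in terms of divisibility by the parameter -/
theorem initial_iff_Rees {k : Type} [Field k] {n : ℕ} (ω : Fin n → ℕ)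
    (I : Ideal (MvPolynomial (Fin n) k)) (c : MvPolynomial (Fin n) k) (e : ℕ)
    (hc : IsWeightedHomogeneous ω c e) :
    c ∈ initialIdeal ω I ↔ ∃ r ∈ Rees ω I,
      Polynomial.monomial e (Ideal.Quotient.mk I c) = Polynomial.X * r := by
  constructor
  · intro h
    obtain ⟨h, h1, h2⟩ := initial_char_mp ω I c h e
    rw [hc.weightedHomogeneousComponent_same, ← Ideal.Quotient.eq] at h2
    cases e with
    | zero =>
      have : h = 0 := by
        ext m; by_contra hm; exact absurd (h1 m hm) (by omega)
      refine ⟨0, zero_mem _, ?_⟩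
      rw [h2, this]; simp
    | succ e =>
      refine ⟨Polynomial.monomial e (Ideal.Quotient.mk I h), monomial_mem_Rees (mk_mem_Fil ?_), ?_⟩
      · intro m hm; exact Nat.le_of_lt_succ (h1 m hm)
      · rw [h2, Polynomial.X_mul_monomial]
  · rintro ⟨r, hr, h⟩
    have h' := congrArg (fun q => Polynomial.coeff q e) h
    simp only [Polynomial.coeff_monomial, if_true] at h'
    cases e with
    | zero =>
      rw [Polynomial.mul_coeff_zero, Polynomial.coeff_X_zero, zero_mul] at h'
      apply initial_char_mpr ω I c 0 0 hc (by simp)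
      rw [sub_zero]; exact Ideal.Quotient.eq_zero_iff_mem.1 h'
    | succ e =>
      rw [Polynomial.coeff_X_mul] at h'
      obtain ⟨g, hg, hg'⟩ := hr e
      apply initial_char_mpr ω I c g (e + 1) hc
      · intro m hm; exact Nat.lt_succ_of_le (hg m hm)
      · rw [← Ideal.Quotient.eq, h', ← hg']; rfl

end part2


section part3
open MvPolynomial

theorem exists_avoid {k K : Type} [Field k] [Field K] [Algebra k K] [Algebra.IsIntegral k K] (r : ℕ) :
    ∀ (f : MvPolynomial (Fin r) K), f ≠ 0 → ∃ μ : Fin r → Polynomial k, (∀ i, (μ i).Monic) ∧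
      (∀ i, 0 < (μ i).natDegree) ∧
      ∀ τ : Fin r → K, (∀ i, Polynomial.aeval (τ i) (μ i) = 0) → eval τ f ≠ 0 := by
  classical
  induction r with
  | zero =>
    intro f hf
    refine ⟨fun _ => 1, fun i => i.elim0, fun i => i.elim0, ?_⟩
    intro τ _ h
    apply hf
    rw [eq_C_of_isEmpty f] at h ⊢
    rw [eval_C] at h
    rw [h, C_0]
  | succ r ih =>
    intro f hf
    set g := finSuccEquiv K r f with hg
    have hg0 : g ≠ 0 := by
      rw [hg]; simpa using hf
    obtain ⟨μ, h1, h2, h3⟩ := ih g.leadingCoeff (by simpa using hg0)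
    let T : Finset (Fin r → K) := Fintype.piFinset (fun i => ((μ i).aroots K).toFinset)
    have hT : ∀ τ : Fin r → K, (∀ i, Polynomial.aeval (τ i) (μ i) = 0) ↔ τ ∈ T := by
      intro τ
      simp only [T, Fintype.mem_piFinset, Multiset.mem_toFinset]
      refine forall_congr' fun i => ?_
      rw [Polynomial.mem_aroots]
      simp [(h1 i).ne_zero]
    let G : Polynomial K := ∏ τ ∈ T, Polynomial.map (eval τ) g
    have hG : G ≠ 0 := by
      apply Finset.prod_ne_zero_iff.2
      intro τ hτ h0
      apply h3 τ ((hT τ).2 hτ)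
      have := congrArg (fun q => Polynomial.coeff q g.natDegree) h0
      simpa [Polynomial.coeff_map] using this
    let χ : Polynomial k := ∏ x ∈ G.roots.toFinset, minpoly k x
    have hχ : χ.Monic := Polynomial.monic_prod_of_monic _ _
      (fun x _ => minpoly.monic (Algebra.IsIntegral.isIntegral x))
    have hXχ : (Polynomial.X * χ).Monic := Polynomial.monic_X.mul hχ
    have hdeg : 0 < (Polynomial.X * χ).degree := by
      rw [Polynomial.degree_mul, Polynomial.degree_X]
      have : 0 ≤ χ.degree := Polynomial.zero_le_degree_iff.2 hχ.ne_zero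
      exact lt_of_lt_of_le zero_lt_one (le_add_of_nonneg_right this)
    have hlt : (1 : Polynomial k).degree < (Polynomial.X * χ).degree := by
      rwa [Polynomial.degree_one]
    refine ⟨Fin.cons (Polynomial.X * χ + 1) μ, ?_, ?_, ?_⟩
    · intro i
      refine Fin.cases ?_ (fun i => ?_) i
      · rw [Fin.cons_zero]; exact hXχ.add_of_left hlt
      · rw [Fin.cons_succ]; exact h1 i
    · intro i
      refine Fin.cases ?_ (fun i => ?_) i
      · rw [Fin.cons_zero, Polynomial.natDegree_add_eq_left_of_degree_lt hlt]
        exact Polynomial.natDegree_pos_iff_degree_pos.2 hdeg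
      · rw [Fin.cons_succ]; exact h2 i
    · intro τ hτ h0
      obtain ⟨y, τ', rfl⟩ : ∃ y τ', τ = Fin.cons y τ' := ⟨τ 0, Fin.tail τ, (Fin.cons_self_tail τ).symm⟩
      rw [eval_eq_eval_mv_eval'] at h0
      have hτ' : τ' ∈ T := (hT τ').1 (fun i => by simpa using hτ i.succ)
      have hy : y ∈ G.roots.toFinset := by
        rw [Multiset.mem_toFinset, Polynomial.mem_roots hG, Polynomial.IsRoot.def, Polynomial.eval_prod]
        exact Finset.prod_eq_zero hτ' h0
      have h4 : Polynomial.aeval y χ = 0 := by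
        rw [map_prod]
        exact Finset.prod_eq_zero hy (minpoly.aeval k y)
      have := hτ 0
      simp [h4] at this

theorem aeval_smul_homog {k K : Type} [Field k] [Field K] [Algebra k K] {m e : ℕ}
    {F : MvPolynomial (Fin m) k} (hF : F.IsHomogeneous e) (c : K) (z : Fin m → K) :
    aeval (fun i => c * z i) F = c ^ e * aeval z F := by
  rw [aeval_def, aeval_def, eval₂_eq', eval₂_eq', Finset.mul_sum]
  apply Finset.sum_congr rfl
  intro d hd
  have := hF (mem_support_iff.1 hd)
  rw [weight_eq_sum] at this
  simp only [Pi.one_apply, one_mul] at this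
  simp only [mul_pow, Finset.prod_mul_distrib, Finset.prod_pow_eq_pow_sum, this]
  ring

theorem aeval_whom {k : Type} [Field k] {n d N e : ℕ} {ω : Fin n → ℕ}
    {F : MvPolynomial (Fin d) k} (hF : F.IsHomogeneous e) (Y : Fin d → MvPolynomial (Fin n) k)
    (hY : ∀ i, IsWeightedHomogeneous ω (Y i) N) :
    IsWeightedHomogeneous ω (aeval Y F) (N * e) := by
  rw [aeval_def, eval₂_eq']
  apply IsWeightedHomogeneous.sum
  intro a ha
  have h1 := hF (mem_support_iff.1 ha)
  rw [weight_eq_sum] at h1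
  simp only [Pi.one_apply, one_mul] at h1
  have h2 := IsWeightedHomogeneous.prod Finset.univ (fun i => Y i ^ a i) (fun i => a i * N) (w := ω)
    (fun i _ => by simpa using (hY i).pow (a i))
  have h3 := (isWeightedHomogeneous_C ω (coeff a F)).mul h2
  rw [← Finset.sum_mul, h1, zero_add, mul_comm e N] at h3
  exact h3

/-- homogenization of a univariate polynomial -/
noncomputable def hgz {k : Type} [Field k] {r : ℕ} (μ : Polynomial k) (i : Fin r) :
    MvPolynomial (Fin (r + 1)) k :=
  ∑ j ∈ Finset.range (μ.natDegree + 1), C (μ.coeff j) * (X i.succ ^ j * X 0 ^ (μ.natDegree - j))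

theorem hgz_homog {k : Type} [Field k] {r : ℕ} (μ : Polynomial k) (i : Fin r) :
    (hgz μ i).IsHomogeneous μ.natDegree := by
  apply IsHomogeneous.sum
  intro j hj
  rw [Finset.mem_range] at hj
  have := (isHomogeneous_C (Fin (r+1)) (μ.coeff j)).mul
    (((isHomogeneous_X k i.succ).pow j).mul ((isHomogeneous_X k (0 : Fin (r+1))).pow (μ.natDegree - j)))
  convert this using 1
  omega

theorem exists_w {k : Type} [Field k] {r e : ℕ} (F : MvPolynomial (Fin (r + 1)) k) (hF : F.IsHomogeneous e)
    (hF0 : F ≠ 0) : ∃ N > 0, ∃ w : Fin r → MvPolynomial (Fin (r + 1)) k, (∀ i, (w i).IsHomogeneous N) ∧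
      ∀ j, X j ∈ (Ideal.span {F} ⊔ Ideal.span (Set.range w)).radical := by
  classical
  let K := AlgebraicClosure k
  let f : MvPolynomial (Fin r) K := aeval (Fin.cons 1 X : Fin (r + 1) → MvPolynomial (Fin r) K) F
  have hev : ∀ τ : Fin r → K, eval τ f = aeval (Fin.cons 1 τ : Fin (r+1) → K) F := by
    intro τ
    have : ((aeval τ : MvPolynomial (Fin r) K →ₐ[K] K).restrictScalars k).comp
        (aeval (Fin.cons 1 X : Fin (r + 1) → MvPolynomial (Fin r) K)) =
        (aeval (Fin.cons 1 τ : Fin (r+1) → K) : MvPolynomial (Fin (r+1)) k →ₐ[k] K) := by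
      apply MvPolynomial.algHom_ext
      intro i
      refine Fin.cases ?_ (fun i => ?_) i <;> simp
    have h := congrArg (fun q => q F) this
    simpa [f, coe_aeval_eq_eval] using h
  have hdh : ∀ z : Fin (r+1) → K, z 0 ≠ 0 → aeval z F = z 0 ^ e * eval (fun i : Fin r => z i.succ / z 0) f := by
    intro z hz
    rw [hev, ← aeval_smul_homog hF]
    congr 2
    funext i
    refine Fin.cases ?_ (fun i => ?_) i
    · simp
    · simp only [Fin.cons_succ]; exact (mul_div_cancel₀ _ hz).symm
  have hf : f ≠ 0 := by
    intro h0
    have : X 0 * map (algebraMap k K) F = 0 := by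
      apply MvPolynomial.funext
      intro z
      rw [map_mul, eval_X, map_zero, eval_map]
      by_cases hz : z 0 = 0
      · rw [hz, zero_mul]
      · have := hdh z hz
        rw [h0, map_zero, mul_zero, aeval_def] at this
        rw [this, mul_zero]
    rcases mul_eq_zero.1 this with h | h
    · exact X_ne_zero _ h
    · apply hF0
      apply map_injective _ (algebraMap k K).injective
      rw [h, map_zero]
  obtain ⟨μ, h1, h2, h3⟩ := exists_avoid (k := k) r f hf
  have hpos : 0 < ∏ i, (μ i).natDegree := Finset.prod_pos fun i _ => h2 i
  have hdvd : ∀ i, (μ i).natDegree ∣ ∏ i, (μ i).natDegree := fun i => Finset.dvd_prod_of_mem _ (Finset.mem_univ i)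
  refine ⟨∏ i, (μ i).natDegree, hpos, fun i => hgz (μ i) i ^ ((∏ i, (μ i).natDegree) / (μ i).natDegree), ?_, ?_⟩
  · intro i
    have := (hgz_homog (μ i) i).pow ((∏ i, (μ i).natDegree) / (μ i).natDegree)
    rwa [Nat.mul_div_cancel' (hdvd i)] at this
  · intro j
    rw [← vanishingIdeal_zeroLocus_eq_radical (K := K), mem_vanishingIdeal_iff]
    intro z hz
    rw [mem_zeroLocus_iff] at hz
    have hzF : aeval z F = 0 := hz F (Ideal.mem_sup_left (Ideal.subset_span rfl))
    have hzw : ∀ i, aeval z (hgz (μ i) i) = 0 := by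
      intro i
      have := hz _ (Ideal.mem_sup_right (Ideal.subset_span ⟨i, rfl⟩))
      rw [map_pow] at this
      exact pow_eq_zero_iff (Nat.div_pos (Nat.le_of_dvd hpos (hdvd i)) (h2 i)).ne' |>.1 this
    have hform : ∀ i, aeval z (hgz (μ i) i) = ∑ j ∈ Finset.range ((μ i).natDegree + 1),
        algebraMap k K ((μ i).coeff j) * (z i.succ ^ j * z 0 ^ ((μ i).natDegree - j)) := by
      intro i
      simp [hgz, map_sum]
    rw [aeval_X]
    by_cases hz0 : z 0 = 0
    · refine Fin.cases hz0 (fun i => ?_) j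
      have := hzw i
      rw [hform, Finset.sum_range_succ, Finset.sum_eq_zero, zero_add, Nat.sub_self, pow_zero, mul_one,
        (h1 i).coeff_natDegree, map_one, one_mul] at this
      · exact pow_eq_zero_iff (h2 i).ne' |>.1 this
      · intro j hj
        rw [Finset.mem_range] at hj
        rw [hz0, zero_pow (by omega), mul_zero, mul_zero]
    · exfalso
      rw [hdh z hz0] at hzF
      have : eval (fun i : Fin r => z i.succ / z 0) f = 0 := by
        rcases mul_eq_zero.1 hzF with h | h
        · exact absurd h (pow_ne_zero _ hz0)
        · exact h
      refine h3 _ ?_ this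
      intro i
      have hh := hzw i
      rw [hform] at hh
      rw [Polynomial.aeval_eq_sum_range]
      apply mul_left_cancel₀ (pow_ne_zero (μ i).natDegree hz0)
      rw [mul_zero, ← hh, Finset.mul_sum]
      apply Finset.sum_congr rfl
      intro j hj
      rw [Finset.mem_range] at hj
      rw [Algebra.smul_def, div_pow]
      have : z 0 ^ (μ i).natDegree = z 0 ^ ((μ i).natDegree - j) * z 0 ^ j := by
        rw [← pow_add]; congr 1; omega
      have hz1 : z 0 ^ j ≠ 0 := pow_ne_zero _ hz0
      have h5 : z 0 ^ j * (z i.succ ^ j / z 0 ^ j) = z i.succ ^ j := mul_div_cancel₀ _ hz1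
      generalize z i.succ ^ j / z 0 ^ j = q at h5 ⊢
      rw [this, ← h5]
      ring

end part3


section part3b
open MvPolynomial

theorem whc_aeval {k : Type} [Field k] {n d N : ℕ} {ω : Fin n → ℕ} (hN : 0 < N)
    (F : MvPolynomial (Fin d) k) (Y : Fin d → MvPolynomial (Fin n) k)
    (hY : ∀ i, IsWeightedHomogeneous ω (Y i) N) (e : ℕ) :
    weightedHomogeneousComponent ω (N * e) (aeval Y F) = aeval Y (homogeneousComponent e F) := by
  classical
  conv_lhs => rw [← sum_homogeneousComponent F, map_sum, map_sum]
  have : ∀ i, weightedHomogeneousComponent ω (N * e) (aeval Y (homogeneousComponent i F)) =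
      if i = e then aeval Y (homogeneousComponent i F) else 0 := by
    intro i
    have h := aeval_whom (homogeneousComponent_isHomogeneous i F) Y hY
    split_ifs with hi
    · subst hi; exact h.weightedHomogeneousComponent_same
    · refine h.weightedHomogeneousComponent_ne _ ?_
      intro hh; exact hi (Nat.eq_of_mul_eq_mul_left hN hh).symm
  rw [Finset.sum_congr rfl (fun i _ => this i), Finset.sum_ite_eq']
  split_ifs with h
  · rfl
  · rw [Finset.mem_range] at h
    rw [homogeneousComponent_eq_zero e F (by omega), map_zero]

theorem noether_aux {k : Type} [Field k] {n : ℕ} {ω : Fin n → ℕ}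
    {J : Ideal (MvPolynomial (Fin n) k)} (hJ : HomogI ω J) (hJ1 : J ≠ ⊤) (m : ℕ) :
    ∀ N, 0 < N → ∀ Y : Fin m → MvPolynomial (Fin n) k, (∀ i, IsWeightedHomogeneous ω (Y i) N) →
      (∀ j, X j ∈ (J ⊔ Ideal.span (Set.range Y)).radical) →
    ∃ d N, 0 < N ∧ ∃ Y : Fin d → MvPolynomial (Fin n) k, (∀ i, IsWeightedHomogeneous ω (Y i) N) ∧
      (∀ j, X j ∈ (J ⊔ Ideal.span (Set.range Y)).radical) ∧
      ∀ F : MvPolynomial (Fin d) k, aeval Y F ∈ J → F = 0 := by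
  induction m with
  | zero =>
    intro N hN Y hY hr
    refine ⟨0, N, hN, Y, hY, hr, ?_⟩
    intro F hF
    by_contra h0
    apply hJ1
    rw [eq_C_of_isEmpty F] at hF h0
    have hc : coeff 0 F ≠ 0 := by intro h; rw [h, C_0] at h0; exact h0 rfl
    rw [aeval_C] at hF
    exact Ideal.eq_top_of_isUnit_mem _ hF ((isUnit_iff_ne_zero.2 hc).map _)
  | succ r ih =>
    intro N hN Y hY hr
    by_cases hker : ∀ F : MvPolynomial (Fin (r + 1)) k, aeval Y F ∈ J → F = 0
    · exact ⟨r + 1, N, hN, Y, hY, hr, hker⟩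
    push Not at hker
    obtain ⟨F, hFJ, hF0⟩ := hker
    obtain ⟨e, he⟩ : ∃ e, homogeneousComponent e F ≠ 0 := by
      by_contra h
      push Not at h
      apply hF0
      rw [← sum_homogeneousComponent F]
      exact Finset.sum_eq_zero fun i _ => h i
    obtain ⟨N', hN', w, hw, hX⟩ := exists_w _ (homogeneousComponent_isHomogeneous e F) he
    refine ih (N * N') (Nat.mul_pos hN hN') (fun i => aeval Y (w i)) (fun i => aeval_whom (hw i) Y hY) ?_
    intro j
    refine (Ideal.radical_le_radical_iff.2 ?_) (hr j)
    refine sup_le (le_trans le_sup_left Ideal.le_radical) ?_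
    rw [Ideal.span_le]
    rintro _ ⟨i, rfl⟩
    obtain ⟨s, hs⟩ := hX i
    refine ⟨s, ?_⟩
    have h1 := Ideal.mem_map_of_mem (aeval Y : MvPolynomial (Fin (r + 1)) k →ₐ[k] MvPolynomial (Fin n) k) hs
    rw [map_pow, aeval_X, Ideal.map_sup, Ideal.map_span, Ideal.map_span] at h1
    refine SetLike.le_def.1 (sup_le_sup ?_ ?_) h1
    · rw [Ideal.span_le]
      rintro _ ⟨_, rfl, rfl⟩
      change aeval Y _ ∈ J
      rw [← whc_aeval hN F Y hY e]
      exact hJ _ hFJ _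
    · apply Ideal.span_mono
      rintro _ ⟨_, ⟨i, rfl⟩, rfl⟩
      exact ⟨i, rfl⟩

theorem noether {k : Type} [Field k] {n : ℕ} {ω : Fin n → ℕ} (hω : ∀ i, 0 < ω i)
    {J : Ideal (MvPolynomial (Fin n) k)} (hJ : HomogI ω J) (hJ1 : J ≠ ⊤) :
    ∃ d N, 0 < N ∧ ∃ Y : Fin d → MvPolynomial (Fin n) k, (∀ i, IsWeightedHomogeneous ω (Y i) N) ∧
      (∀ j, X j ∈ (J ⊔ Ideal.span (Set.range Y)).radical) ∧
      ∀ F : MvPolynomial (Fin d) k, aeval Y F ∈ J → F = 0 := by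
  have hpos : 0 < ∏ i, ω i := Finset.prod_pos fun i _ => hω i
  have hdvd : ∀ i, ω i ∣ ∏ i, ω i := fun i => Finset.dvd_prod_of_mem _ (Finset.mem_univ i)
  refine noether_aux hJ hJ1 n (∏ i, ω i) hpos (fun i => X i ^ ((∏ i, ω i) / ω i)) ?_ ?_
  · intro i
    have := (isWeightedHomogeneous_X k ω i).pow ((∏ i, ω i) / ω i)
    rwa [smul_eq_mul, Nat.div_mul_cancel (hdvd i)] at this
  · intro j
    exact ⟨_, Ideal.mem_sup_right (Ideal.subset_span ⟨j, rfl⟩)⟩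

end part3b


section part4
open MvPolynomial

/-- the parameter map to polynomials over the quotient -/
noncomputable def Thet {k : Type} [Field k] {n d : ℕ} (N : ℕ) (I : Ideal (MvPolynomial (Fin n) k))
    (Y : Fin d → MvPolynomial (Fin n) k) :
    Polynomial (MvPolynomial (Fin d) k) →+* Polynomial (MvPolynomial (Fin n) k ⧸ I) :=
  Polynomial.eval₂RingHom (MvPolynomial.eval₂Hom
    ((Polynomial.C).comp (algebraMap k (MvPolynomial (Fin n) k ⧸ I)))
    (fun i => Polynomial.monomial N (Ideal.Quotient.mk I (Y i)))) Polynomial.X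

theorem Thet_X {k : Type} [Field k] {n d : ℕ} (N : ℕ) (I : Ideal (MvPolynomial (Fin n) k))
    (Y : Fin d → MvPolynomial (Fin n) k) : Thet N I Y Polynomial.X = Polynomial.X := by
  simp [Thet]

theorem Thet_CX {k : Type} [Field k] {n d : ℕ} (N : ℕ) (I : Ideal (MvPolynomial (Fin n) k))
    (Y : Fin d → MvPolynomial (Fin n) k) (i : Fin d) :
    Thet N I Y (Polynomial.C (X i)) = Polynomial.monomial N (Ideal.Quotient.mk I (Y i)) := by
  simp [Thet]

theorem Thet_CC {k : Type} [Field k] {n d : ℕ} (N : ℕ) (I : Ideal (MvPolynomial (Fin n) k))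
    (Y : Fin d → MvPolynomial (Fin n) k) (c : k) :
    Thet N I Y (Polynomial.C (C c)) = Polynomial.C (Ideal.Quotient.mk I (C c)) := by
  simp [Thet]; rfl

theorem prod_mono_pow {D : Type} [CommRing D] {d : ℕ} (N : ℕ) (y : Fin d → D) (a : Fin d → ℕ) (c : D) :
    Polynomial.C c * ∏ i, (Polynomial.monomial N (y i)) ^ a i =
      Polynomial.monomial (N * ∑ i, a i) (c * ∏ i, y i ^ a i) := by
  simp only [← Polynomial.C_mul_X_pow_eq_monomial, mul_pow, Finset.prod_mul_distrib, ← pow_mul,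
    Finset.prod_pow_eq_pow_sum, ← Finset.mul_sum, map_mul, map_prod, map_pow]
  rw [mul_assoc]

theorem Thet_homog {k : Type} [Field k] {n d : ℕ} (N : ℕ) (I : Ideal (MvPolynomial (Fin n) k))
    (Y : Fin d → MvPolynomial (Fin n) k) (F : MvPolynomial (Fin d) k) (e : ℕ) (hF : F.IsHomogeneous e) :
    Thet N I Y (Polynomial.C F) = Polynomial.monomial (N * e) (Ideal.Quotient.mk I (aeval Y F)) := by
  rw [Thet, Polynomial.coe_eval₂RingHom, Polynomial.eval₂_C, coe_eval₂Hom, eval₂_eq', aeval_def,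
    eval₂_eq', map_sum, map_sum]
  apply Finset.sum_congr rfl
  intro a ha
  have h1 := hF (mem_support_iff.1 ha)
  rw [weight_eq_sum] at h1
  simp only [Pi.one_apply, one_mul] at h1
  have h2 := prod_mono_pow N (fun i => Ideal.Quotient.mk I (Y i)) a
    (algebraMap k (MvPolynomial (Fin n) k ⧸ I) (coeff a F))
  rw [h1] at h2
  rw [map_mul, map_prod]
  simp only [map_pow]
  exact h2

theorem Thet_mem {k : Type} [Field k] {n d : ℕ} {ω : Fin n → ℕ} (N : ℕ) (I : Ideal (MvPolynomial (Fin n) k))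
    (Y : Fin d → MvPolynomial (Fin n) k) (hY : ∀ i, IsWeightedHomogeneous ω (Y i) N)
    (s : Polynomial (MvPolynomial (Fin d) k)) : Thet N I Y s ∈ Rees ω I := by
  induction s using Polynomial.induction_on' with
  | add p q hp hq => rw [map_add]; exact add_mem hp hq
  | monomial j F =>
    rw [← Polynomial.C_mul_X_pow_eq_monomial, map_mul, map_pow, Thet_X]
    refine mul_mem ?_ (pow_mem X_mem_Rees _)
    induction F using MvPolynomial.induction_on with
    | C c =>
      rw [Thet_CC]
      exact monomial_mem_Rees (l := 0) (mk_mem_Fil (whom_mem_wle (isWeightedHomogeneous_C ω c)))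
    | add p q hp hq => rw [map_add, map_add]; exact add_mem hp hq
    | mul_X p i hp =>
      rw [map_mul, map_mul, Thet_CX]
      exact mul_mem hp (monomial_mem_Rees (mk_mem_Fil (whom_mem_wle (hY i))))

theorem Thet_dvd {k : Type} [Field k] {n d : ℕ} {ω : Fin n → ℕ} (N : ℕ) (hN : 0 < N)
    (I : Ideal (MvPolynomial (Fin n) k))
    (Y : Fin d → MvPolynomial (Fin n) k) (hY : ∀ i, IsWeightedHomogeneous ω (Y i) N)
    (hinj : ∀ F : MvPolynomial (Fin d) k, aeval Y F ∈ initialIdeal ω I → F = 0)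
    (F : MvPolynomial (Fin d) k) (r) (hr : r ∈ Rees ω I)
    (h : Thet N I Y (Polynomial.C F) = Polynomial.X * r) : F = 0 := by
  classical
  rw [← sum_homogeneousComponent F]
  apply Finset.sum_eq_zero
  intro e he
  apply hinj
  rw [initial_iff_Rees ω I _ _ (aeval_whom (homogeneousComponent_isHomogeneous e F) Y hY)]
  have h1 : (Thet N I Y (Polynomial.C F)).coeff (N * e) =
      Ideal.Quotient.mk I (aeval Y (homogeneousComponent e F)) := by
    conv_lhs => rw [← sum_homogeneousComponent F, map_sum, map_sum, Polynomial.finsetSum_coeff]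
    rw [Finset.sum_eq_single e]
    · rw [Thet_homog N I Y _ _ (homogeneousComponent_isHomogeneous e F), Polynomial.coeff_monomial, if_pos rfl]
    · intro b _ hb
      rw [Thet_homog N I Y _ _ (homogeneousComponent_isHomogeneous b F), Polynomial.coeff_monomial, if_neg]
      intro h; exact hb (Nat.eq_of_mul_eq_mul_left hN h)
    · intro h; exact absurd he h
  rw [← h1, h]
  cases hq : N * e with
  | zero => exact ⟨0, zero_mem _, by simp⟩
  | succ q =>
    refine ⟨Polynomial.monomial q (r.coeff q), monomial_mem_Rees (hr q), ?_⟩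
    rw [Polynomial.coeff_X_mul, Polynomial.X_mul_monomial]

theorem Thet_inj {k : Type} [Field k] {n d : ℕ} {ω : Fin n → ℕ} (N : ℕ) (hN : 0 < N)
    (I : Ideal (MvPolynomial (Fin n) k))
    (Y : Fin d → MvPolynomial (Fin n) k) (hY : ∀ i, IsWeightedHomogeneous ω (Y i) N)
    (hinj : ∀ F : MvPolynomial (Fin d) k, aeval Y F ∈ initialIdeal ω I → F = 0) :
    Function.Injective (Thet N I Y) := by
  rw [injective_iff_map_eq_zero]
  have h0 : ∀ s, Thet N I Y s = 0 → s.coeff 0 = 0 ∧ Thet N I Y s.divX = 0 := by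
    intro s hs
    have h1 := Polynomial.divX_mul_X_add s
    have h2 := congrArg (Thet N I Y) h1
    rw [hs, map_add, map_mul, Thet_X] at h2
    have h3 : s.coeff 0 = 0 := by
      apply Thet_dvd N hN I Y hY hinj _ (- Thet N I Y s.divX) (neg_mem (Thet_mem N I Y hY _))
      linear_combination h2
    refine ⟨h3, ?_⟩
    rw [h3, map_zero, map_zero, add_zero] at h2
    ext j
    have := congrArg (fun q => Polynomial.coeff q (j + 1)) h2
    simpa using this
  have h1 : ∀ j s, Thet N I Y s = 0 → s.coeff j = 0 := by
    intro j
    induction j with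
    | zero => intro s hs; exact (h0 s hs).1
    | succ j ih =>
      intro s hs
      have := ih _ (h0 s hs).2
      rwa [Polynomial.coeff_divX] at this
  intro s hs
  ext1 j
  rw [h1 j s hs, Polynomial.coeff_zero]

/-- weighted degree bound -/
def WS {k : Type} [Field k] {d : ℕ} (N i c : ℕ) (s : Polynomial (MvPolynomial (Fin d) k)) : Prop :=
  ∀ j m, coeff m (s.coeff j) ≠ 0 → N * m.degree + j + c ≤ i

theorem WS.add {k : Type} [Field k] {d N i c : ℕ} {s s' : Polynomial (MvPolynomial (Fin d) k)}
    (h : WS N i c s) (h' : WS N i c s') : WS N i c (s + s') := by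
  intro j m hm
  rw [Polynomial.coeff_add, coeff_add] at hm
  by_cases h1 : coeff m (s.coeff j) = 0
  · rw [h1, zero_add] at hm; exact h' j m hm
  · exact h j m h1

theorem WS.zero {k : Type} [Field k] {d N i c : ℕ} : WS N i c (0 : Polynomial (MvPolynomial (Fin d) k)) := by
  intro j m hm; simp at hm

theorem WS.sum {k : Type} [Field k] {d N i c : ℕ} {ι : Type} (T : Finset ι)
    (s : ι → Polynomial (MvPolynomial (Fin d) k)) (h : ∀ b ∈ T, WS N i c (s b)) : WS N i c (∑ b ∈ T, s b) := by
  classical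
  induction T using Finset.induction_on with
  | empty => exact WS.zero
  | insert a T ha ih =>
    rw [Finset.sum_insert ha]
    exact (h a (Finset.mem_insert_self _ _)).add (ih fun b hb => h b (Finset.mem_insert_of_mem hb))

theorem WS.mul {k : Type} [Field k] {d N i i' c c' : ℕ} {s s' : Polynomial (MvPolynomial (Fin d) k)}
    (h : WS N i c s) (h' : WS N i' c' s') : WS N (i + i') (c + c') (s * s') := by
  classical
  intro j m hm
  rw [Polynomial.coeff_mul, coeff_sum] at hm
  obtain ⟨x, hx, hx0⟩ := Finset.exists_ne_zero_of_sum_ne_zero hm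
  rw [Finset.HasAntidiagonal.mem_antidiagonal] at hx
  rw [coeff_mul] at hx0
  obtain ⟨y, hy, hy0⟩ := Finset.exists_ne_zero_of_sum_ne_zero hx0
  rw [Finset.HasAntidiagonal.mem_antidiagonal] at hy
  have h1 := h _ _ (left_ne_zero_of_mul hy0)
  have h2 := h' _ _ (right_ne_zero_of_mul hy0)
  rw [← hx, ← hy, map_add, mul_add]
  omega

theorem WS.mono {k : Type} [Field k] {d N i i' c c' : ℕ} {s : Polynomial (MvPolynomial (Fin d) k)}
    (h : WS N i c s) (hi : i ≤ i') (hc : c' ≤ c) : WS N i' c' s := by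
  intro j m hm
  have := h j m hm
  omega

theorem WS.mono' {k : Type} [Field k] {d N i i' c c' : ℕ} {s : Polynomial (MvPolynomial (Fin d) k)}
    (h : WS N i c s) (hi : i + c' ≤ i' + c) : WS N i' c' s := by
  intro j m hm
  have := h j m hm
  omega

theorem WS_X {k : Type} [Field k] {d N : ℕ} : WS N 1 0 (Polynomial.X : Polynomial (MvPolynomial (Fin d) k)) := by
  classical
  intro j m hm
  rw [Polynomial.coeff_X] at hm
  split_ifs at hm with h
  · rw [coeff_one] at hm
    split_ifs at hm with h1
    · subst h h1; simp
    · exact absurd rfl hm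
  · simp at hm

theorem WS_CX {k : Type} [Field k] {d N : ℕ} (i : Fin d) :
    WS N N 0 (Polynomial.C (X i : MvPolynomial (Fin d) k)) := by
  classical
  intro j m hm
  rw [Polynomial.coeff_C] at hm
  split_ifs at hm with h
  · rw [coeff_X] at hm
    split_ifs at hm with h1
    · subst h h1; simp
    · exact absurd rfl hm
  · simp at hm

theorem WS_CC {k : Type} [Field k] {d N : ℕ} (a : k) :
    WS N 0 0 (Polynomial.C (C a : MvPolynomial (Fin d) k)) := by
  classical
  intro j m hm
  rw [Polynomial.coeff_C] at hm
  split_ifs at hm with h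
  · rw [coeff_C] at hm
    split_ifs at hm with h1
    · subst h h1; simp
    · exact absurd rfl hm
  · simp at hm

theorem WS_exists {k : Type} [Field k] {d N : ℕ} (s : Polynomial (MvPolynomial (Fin d) k)) :
    ∃ i, WS N i 0 s := by
  refine ⟨∑ j ∈ s.support, (N * (s.coeff j).totalDegree + j), ?_⟩
  intro j m hm
  have h1 : s.coeff j ≠ 0 := by intro h; rw [h] at hm; simp at hm
  have h2 := Finset.single_le_sum (f := fun j => N * (s.coeff j).totalDegree + j)
    (fun _ _ => Nat.zero_le _) (Polynomial.mem_support_iff.2 h1)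
  have h3 : m.degree ≤ (s.coeff j).totalDegree := by
    have := le_totalDegree (mem_support_iff.2 hm)
    simpa [Finsupp.degree_eq_sum, Finsupp.sum_fintype] using this
  have := Nat.mul_le_mul_left N h3
  omega

end part4


section part4b
open MvPolynomial

/-- exponent vector -/
noncomputable def bexp {n l : ℕ} (b : Fin n → Fin l) : Fin n →₀ ℕ :=
  Finsupp.equivFunOnFinite.symm (fun i => (b i : ℕ))

/-- generators -/
noncomputable def Phi {k : Type} [Field k] {n l : ℕ} (ω : Fin n → ℕ) (I : Ideal (MvPolynomial (Fin n) k))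
    (b : Fin n → Fin l) : Polynomial (MvPolynomial (Fin n) k ⧸ I) :=
  Polynomial.monomial (Finsupp.weight ω (bexp b)) (Ideal.Quotient.mk I (monomial (bexp b) 1))

/-- combinations of bounded degree -/
def GEN {k : Type} [Field k] {n d : ℕ} (ω : Fin n → ℕ) (N l : ℕ) (I : Ideal (MvPolynomial (Fin n) k))
    (Y : Fin d → MvPolynomial (Fin n) k) (i : ℕ) (r : Polynomial (MvPolynomial (Fin n) k ⧸ I)) : Prop :=
  ∃ s : (Fin n → Fin l) → Polynomial (MvPolynomial (Fin d) k),
    (∀ b, WS N i (Finsupp.weight ω (bexp b)) (s b)) ∧ r = ∑ b, Thet N I Y (s b) * Phi ω I b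

theorem GEN.add {k : Type} [Field k] {n d : ℕ} {ω : Fin n → ℕ} {N l : ℕ} {I : Ideal (MvPolynomial (Fin n) k)}
    {Y : Fin d → MvPolynomial (Fin n) k} {i : ℕ} {r r' : Polynomial (MvPolynomial (Fin n) k ⧸ I)}
    (h : GEN ω N l I Y i r) (h' : GEN ω N l I Y i r') : GEN ω N l I Y i (r + r') := by
  obtain ⟨s, h1, rfl⟩ := h
  obtain ⟨s', h1', rfl⟩ := h'
  refine ⟨fun b => s b + s' b, fun b => (h1 b).add (h1' b), ?_⟩
  simp only [map_add, add_mul, Finset.sum_add_distrib]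

theorem GEN.zero {k : Type} [Field k] {n d : ℕ} {ω : Fin n → ℕ} {N l : ℕ} {I : Ideal (MvPolynomial (Fin n) k)}
    {Y : Fin d → MvPolynomial (Fin n) k} {i : ℕ} : GEN ω N l I Y i 0 :=
  ⟨fun _ => 0, fun _ => WS.zero, by simp⟩

theorem GEN.sum {k : Type} [Field k] {n d : ℕ} {ω : Fin n → ℕ} {N l : ℕ} {I : Ideal (MvPolynomial (Fin n) k)}
    {Y : Fin d → MvPolynomial (Fin n) k} {i : ℕ} {ι : Type} (T : Finset ι)
    (r : ι → Polynomial (MvPolynomial (Fin n) k ⧸ I)) (h : ∀ b ∈ T, GEN ω N l I Y i (r b)) :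
    GEN ω N l I Y i (∑ b ∈ T, r b) := by
  classical
  induction T using Finset.induction_on with
  | empty => exact GEN.zero
  | insert a T ha ih =>
    rw [Finset.sum_insert ha]
    exact (h a (Finset.mem_insert_self _ _)).add (ih fun b hb => h b (Finset.mem_insert_of_mem hb))

theorem GEN.mono {k : Type} [Field k] {n d : ℕ} {ω : Fin n → ℕ} {N l : ℕ} {I : Ideal (MvPolynomial (Fin n) k)}
    {Y : Fin d → MvPolynomial (Fin n) k} {i i' : ℕ} {r : Polynomial (MvPolynomial (Fin n) k ⧸ I)}
    (h : GEN ω N l I Y i r) (hi : i ≤ i') : GEN ω N l I Y i' r := by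
  obtain ⟨s, h1, rfl⟩ := h
  exact ⟨s, fun b => (h1 b).mono hi le_rfl, rfl⟩

theorem GEN.smul {k : Type} [Field k] {n d : ℕ} {ω : Fin n → ℕ} {N l : ℕ} {I : Ideal (MvPolynomial (Fin n) k)}
    {Y : Fin d → MvPolynomial (Fin n) k} {i i' : ℕ} {r : Polynomial (MvPolynomial (Fin n) k ⧸ I)}
    {s : Polynomial (MvPolynomial (Fin d) k)} (hs : WS N i' 0 s)
    (h : GEN ω N l I Y i r) : GEN ω N l I Y (i' + i) (Thet N I Y s * r) := by
  obtain ⟨s', h1, rfl⟩ := h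
  refine ⟨fun b => s * s' b, fun b => ?_, ?_⟩
  · simpa using hs.mul (h1 b)
  · simp only [map_mul, Finset.mul_sum, mul_assoc]

theorem GEN.X {k : Type} [Field k] {n d : ℕ} {ω : Fin n → ℕ} {N l : ℕ} {I : Ideal (MvPolynomial (Fin n) k)}
    {Y : Fin d → MvPolynomial (Fin n) k} {i : ℕ} {r : Polynomial (MvPolynomial (Fin n) k ⧸ I)}
    (h : GEN ω N l I Y i r) (a : ℕ) : GEN ω N l I Y (i + a) (Polynomial.X ^ a * r) := by
  induction a with
  | zero => simpa using h
  | succ a ih =>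
    have := ih.smul WS_X
    rw [Thet_X, ← mul_assoc, ← pow_succ'] at this
    exact this.mono (by omega)

theorem GEN.base {k : Type} [Field k] {n d : ℕ} {ω : Fin n → ℕ} {N l : ℕ} {I : Ideal (MvPolynomial (Fin n) k)}
    {Y : Fin d → MvPolynomial (Fin n) k} (b : Fin n → Fin l) :
    GEN ω N l I Y (Finsupp.weight ω (bexp b)) (Phi ω I b) := by
  classical
  refine ⟨fun b' => if b' = b then 1 else 0, fun b' => ?_, ?_⟩
  · simp only
    split_ifs with h
    · subst h
      have := WS_CC (d := d) (N := N) (1 : k)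
      rw [map_one, map_one] at this
      exact this.mono' (by omega)
    · exact WS.zero
  · rw [Finset.sum_eq_single b]
    · simp
    · intro c _ hc; simp [hc]
    · simp

theorem whc_homog_mul {k : Type} [Field k] {n : ℕ} (ω : Fin n → ℕ) (y : MvPolynomial (Fin n) k) (N : ℕ)
    (hy : IsWeightedHomogeneous ω y N)
    (f : MvPolynomial (Fin n) k) (e : ℕ) :
    weightedHomogeneousComponent ω e (y * f) =
      if N ≤ e then y * weightedHomogeneousComponent ω (e - N) f else 0 := by
  classical
  conv_lhs => rw [y.as_sum, Finset.sum_mul, map_sum]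
  rw [Finset.sum_congr rfl (g := fun u => if N ≤ e then monomial u (coeff u y) *
    weightedHomogeneousComponent ω (e - N) f else 0)]
  · split_ifs with h
    · rw [← Finset.sum_mul, ← y.as_sum]
    · simp
  · intro u hu
    rw [whc_monomial_mul, hy (mem_support_iff.1 hu)]

theorem GEN_of_wle {k : Type} [Field k] {n d : ℕ} {ω : Fin n → ℕ} {N l : ℕ} {I : Ideal (MvPolynomial (Fin n) k)}
    {Y : Fin d → MvPolynomial (Fin n) k} {i : ℕ}
    (ih : ∀ j ≤ i, ∀ f, IsWeightedHomogeneous ω f j →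
      GEN ω N l I Y j (Polynomial.monomial j (Ideal.Quotient.mk I f)))
    (h : MvPolynomial (Fin n) k) (hh : h ∈ wle k ω i) (q : ℕ) :
    GEN ω N l I Y (i + q) (Polynomial.monomial (i + q) (Ideal.Quotient.mk I h)) := by
  rw [sum_whc ω h i hh, map_sum, map_sum]
  apply GEN.sum
  intro j hj
  have hj' : j ≤ i := by rw [Finset.mem_range] at hj; omega
  have := (ih j hj' _ (weightedHomogeneousComponent_isWeightedHomogeneous j h)).X (i + q - j)
  rw [Polynomial.X_pow_mul_monomial] at this
  have h1 : j + (i + q - j) = i + q := by omega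
  rwa [h1] at this

theorem GEN_homog {k : Type} [Field k] {n d : ℕ} {ω : Fin n → ℕ} {N l : ℕ} (hN : 0 < N)
    {I : Ideal (MvPolynomial (Fin n) k)}
    {Y : Fin d → MvPolynomial (Fin n) k} (hY : ∀ i, IsWeightedHomogeneous ω (Y i) N)
    (hl : ∀ j, X j ^ l ∈ initialIdeal ω I ⊔ Ideal.span (Set.range Y)) (i : ℕ) :
    ∀ f, IsWeightedHomogeneous ω f i →
      GEN ω N l I Y i (Polynomial.monomial i (Ideal.Quotient.mk I f)) := by
  induction i using Nat.strong_induction_on with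
  | _ i ih =>
  have key : ∀ u, Finsupp.weight ω u = i →
      GEN ω N l I Y i (Polynomial.monomial i (Ideal.Quotient.mk I (monomial u 1))) := by
    intro u hu
    by_cases hul : ∀ j, u j < l
    · have hb : bexp (fun j => (⟨u j, hul j⟩ : Fin l)) = u := by ext j; simp [bexp]
      have := GEN.base (ω := ω) (N := N) (I := I) (Y := Y) (fun j => (⟨u j, hul j⟩ : Fin l))
      rw [Phi, hb, hu] at this
      exact this
    · push Not at hul
      obtain ⟨j, hj⟩ := hul
      obtain ⟨c, hc, z, hz, hcz⟩ := Submodule.mem_sup.1 (hl j)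
      obtain ⟨h, rfl⟩ := (Ideal.mem_span_range_iff_exists_fun).1 hz
      set g : MvPolynomial (Fin n) k := monomial (u - Finsupp.single j l) 1 with hg
      have hf : monomial u (1 : k) = X j ^ l * g := by
        rw [hg, X_pow_eq_monomial, monomial_mul, one_mul, add_tsub_cancel_of_le]
        simpa using hj
      have hf2 : monomial u (1 : k) = weightedHomogeneousComponent ω i (c * g) +
          ∑ r, weightedHomogeneousComponent ω i (Y r * (h r * g)) := by
        rw [← map_sum, ← map_add]
        rw [← (isWeightedHomogeneous_monomial ω u (1 : k) hu).weightedHomogeneousComponent_same]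
        congr 1
        rw [hf, ← hcz, add_mul, Finset.sum_mul]
        congr 1
        apply Finset.sum_congr rfl
        intro r _; ring
      rw [hf2, map_add, map_add, map_sum, map_sum]
      apply GEN.add
      · obtain ⟨h', h1, h2⟩ := initial_char_mp ω I (c * g) (Ideal.mul_mem_right _ _ hc) i
        rw [← Ideal.Quotient.eq] at h2
        rw [h2]
        cases i with
        | zero =>
          have : h' = 0 := by
            ext m; by_contra hm; exact absurd (h1 m hm) (by omega)
          rw [this, map_zero, map_zero]; exact GEN.zero
        | succ i =>
          exact GEN_of_wle (fun j hj => ih j (by omega)) h' (fun m hm => Nat.le_of_lt_succ (h1 m hm)) 1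
      · apply GEN.sum
        intro r _
        rw [whc_homog_mul ω _ N (hY r)]
        split_ifs with hNi
        · have := (ih (i - N) (by omega) _
            (weightedHomogeneousComponent_isWeightedHomogeneous (i - N) (h r * g))).smul (WS_CX r)
          rw [Thet_CX, Polynomial.monomial_mul_monomial, Nat.add_sub_cancel' hNi] at this
          rw [map_mul]
          exact this
        · rw [map_zero, map_zero]; exact GEN.zero
  intro f hf
  rw [f.as_sum, map_sum, map_sum]
  apply GEN.sum
  intro u hu
  have := (key u (hf (mem_support_iff.1 hu))).smul (WS_CC (coeff u f))
  rw [Thet_CC, zero_add, Polynomial.C_mul_monomial, ← map_mul, C_mul_monomial, mul_one] at this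
  exact this

theorem GEN_Rees {k : Type} [Field k] {n d : ℕ} {ω : Fin n → ℕ} {N l : ℕ} (hN : 0 < N)
    {I : Ideal (MvPolynomial (Fin n) k)}
    {Y : Fin d → MvPolynomial (Fin n) k} (hY : ∀ i, IsWeightedHomogeneous ω (Y i) N)
    (hl : ∀ j, X j ^ l ∈ initialIdeal ω I ⊔ Ideal.span (Set.range Y))
    (r : Polynomial (MvPolynomial (Fin n) k ⧸ I)) (hr : r ∈ Rees ω I) :
    GEN ω N l I Y r.natDegree r := by
  have : GEN ω N l I Y r.natDegree (∑ i ∈ Finset.range (r.natDegree + 1), Polynomial.monomial i (r.coeff i)) := by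
    apply GEN.sum
    intro i hi
    obtain ⟨h, h1, h2⟩ := hr i
    have := GEN_of_wle (ω := ω) (N := N) (l := l) (I := I) (Y := Y)
      (fun j (_ : j ≤ i) => GEN_homog hN hY hl j) h h1 0
    rw [← h2]
    rw [Finset.mem_range] at hi
    exact this.mono (by omega)
  rwa [← Polynomial.as_sum_range] at this

theorem Phi_mem {k : Type} [Field k] {n l : ℕ} (ω : Fin n → ℕ) (I : Ideal (MvPolynomial (Fin n) k))
    (b : Fin n → Fin l) : Phi ω I b ∈ Rees ω I :=
  monomial_mem_Rees (mk_mem_Fil (whom_mem_wle (isWeightedHomogeneous_monomial ω _ _ rfl)))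

theorem exists_phi {S R : Type} [CommRing S] [IsDomain S] [CommRing R] [IsDomain R] [Algebra S R]
    (hinj : Function.Injective (algebraMap S R)) [Module.Finite S R] : ∃ φ : R →ₗ[S] S, φ ≠ 0 := by
  classical
  haveI : FaithfulSMul S R := (faithfulSMul_iff_algebraMap_injective S R).2 hinj
  let K := FractionRing S
  let L := FractionRing R
  letI : Algebra K L := FractionRing.liftAlgebra S L
  haveI : IsScalarTower S K L := FractionRing.isScalarTower_liftAlgebra S L
  obtain ⟨f, hf⟩ := LinearMap.exists_leftInverse_of_injective (Algebra.linearMap K L)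
    (LinearMap.ker_eq_bot.2 (algebraMap K L).injective)
  let g : R →ₗ[S] K := (f.restrictScalars S).comp ((IsScalarTower.toAlgHom S R L).toLinearMap)
  have hg1 : g 1 = 1 := by
    have := congrArg (fun q => q 1) hf
    simpa [g] using this
  obtain ⟨T, hT⟩ := (Module.Finite.fg_top : (⊤ : Submodule S R).FG)
  obtain ⟨c, hc⟩ := IsLocalization.exist_integer_multiples_of_finset (nonZeroDivisors S) (T.image g)
  let g' : R →ₗ[S] K := (c : S) • g
  have hg' : ∀ r, g' r ∈ LinearMap.range (Algebra.linearMap S K) := by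
    intro r
    have : (⊤ : Submodule S R) ≤ (LinearMap.range (Algebra.linearMap S K)).comap g' := by
      rw [← hT, Submodule.span_le]
      intro t ht
      obtain ⟨q, hq⟩ := hc (g t) (Finset.mem_image_of_mem g ht)
      exact ⟨q, hq⟩
    exact this trivial
  let e := LinearEquiv.ofInjective (Algebra.linearMap S K) (IsFractionRing.injective S K)
  refine ⟨e.symm.toLinearMap.comp (LinearMap.codRestrict _ g' hg'), ?_⟩
  intro h0
  have h1 := congrArg (fun q => q 1) h0
  simp only [LinearMap.comp_apply, LinearEquiv.coe_coe, LinearMap.zero_apply, LinearEquiv.map_eq_zero_iff] at h1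
  have h2 : g' 1 = 0 := congrArg Subtype.val h1
  have h3 : g' 1 = algebraMap S K c := by
    change (c : S) • g 1 = _
    rw [hg1, Algebra.smul_def, mul_one]
  rw [h3] at h2
  exact nonZeroDivisors.coe_ne_zero c ((IsFractionRing.injective S K) (by rw [h2, map_zero]))

end part4b


section part5
open MvPolynomial

theorem HomogI.sup {k : Type} [Field k] {n : ℕ} {ω : Fin n → ℕ} {a b : Ideal (MvPolynomial (Fin n) k)}
    (ha : HomogI ω a) (hb : HomogI ω b) : HomogI ω (a ⊔ b) := by
  intro f hf l
  obtain ⟨x, hx, y, hy, rfl⟩ := Submodule.mem_sup.1 hf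
  rw [map_add]
  exact Submodule.add_mem_sup (ha x hx l) (hb y hy l)

theorem HomogI.le_of {k : Type} [Field k] {n : ℕ} {ω : Fin n → ℕ} {a b : Ideal (MvPolynomial (Fin n) k)}
    (ha : HomogI ω a) (h : ∀ e f, f ∈ a → IsWeightedHomogeneous ω f e → f ∈ b) : a ≤ b := by
  intro f hf
  rw [sum_whc ω f _ (mem_wle_wDeg ω f)]
  exact sum_mem fun e _ => h e _ (ha f hf e) (weightedHomogeneousComponent_isWeightedHomogeneous e f)

/-- homogeneous element in the Rees ring -/
noncomputable def hom {k : Type} [Field k] {n : ℕ} {ω : Fin n → ℕ} (I : Ideal (MvPolynomial (Fin n) k))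
    (f : MvPolynomial (Fin n) k) (e : ℕ) (hf : IsWeightedHomogeneous ω f e) : Rees ω I :=
  ⟨Polynomial.monomial e (Ideal.Quotient.mk I f), monomial_mem_Rees (mk_mem_Fil (whom_mem_wle hf))⟩

theorem hom_mul {k : Type} [Field k] {n : ℕ} {ω : Fin n → ℕ} (I : Ideal (MvPolynomial (Fin n) k))
    (f g : MvPolynomial (Fin n) k) (e e' : ℕ) (hf : IsWeightedHomogeneous ω f e)
    (hg : IsWeightedHomogeneous ω g e') : hom I f e hf * hom I g e' hg = hom I (f * g) (e + e') (hf.mul hg) := by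
  apply Subtype.ext
  simp [hom, Polynomial.monomial_mul_monomial]

theorem hom_pow {k : Type} [Field k] {n : ℕ} {ω : Fin n → ℕ} (I : Ideal (MvPolynomial (Fin n) k))
    (f : MvPolynomial (Fin n) k) (e m : ℕ) (hf : IsWeightedHomogeneous ω f e) :
    hom I f e hf ^ m = hom I (f ^ m) (m * e) (hf.pow m) := by
  apply Subtype.ext
  simp [hom, Polynomial.monomial_pow, mul_comm]

theorem hom_dvd {k : Type} [Field k] {n : ℕ} {ω : Fin n → ℕ} (I : Ideal (MvPolynomial (Fin n) k))
    (f : MvPolynomial (Fin n) k) (e : ℕ) (hf : IsWeightedHomogeneous ω f e) :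
    (⟨Polynomial.X, X_mem_Rees⟩ : Rees ω I) ∣ hom I f e hf ↔ f ∈ initialIdeal ω I := by
  rw [initial_iff_Rees ω I f e hf]
  constructor
  · rintro ⟨r, hr⟩
    exact ⟨r, r.2, congrArg Subtype.val hr⟩
  · rintro ⟨r, hr, h⟩
    exact ⟨⟨r, hr⟩, Subtype.ext h⟩

theorem conn_alg {k : Type} [Field k] {n d : ℕ} {ω : Fin n → ℕ} {N l : ℕ} (hN : 0 < N)
    {I : Ideal (MvPolynomial (Fin n) k)} (hI : I.IsPrime)
    {Y : Fin d → MvPolynomial (Fin n) k} (hY : ∀ i, IsWeightedHomogeneous ω (Y i) N)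
    (hl : ∀ j, X j ^ l ∈ initialIdeal ω I ⊔ Ideal.span (Set.range Y))
    (hinj : ∀ F : MvPolynomial (Fin d) k, aeval Y F ∈ initialIdeal ω I → F = 0)
    {𝔞 𝔟 : Ideal (MvPolynomial (Fin n) k)} (ha : HomogI ω 𝔞) (hb : HomogI ω 𝔟)
    (hab : ∀ x ∈ 𝔞, ∀ y ∈ 𝔟, x * y ∈ initialIdeal ω I)
    (hq0 : ∃ F : MvPolynomial (Fin d) k, F ≠ 0 ∧ aeval Y F ∈ 𝔞 ⊔ 𝔟)
    (hq1 : ∀ h : MvPolynomial (Fin d) k, Prime h → ∃ F, aeval Y F ∈ 𝔞 ⊔ 𝔟 ∧ ¬ h ∣ F) :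
    𝔞 ≤ (initialIdeal ω I).radical ∨ 𝔟 ≤ (initialIdeal ω I).radical := by
  classical
  let ι := {x : ℕ × MvPolynomial (Fin d) k // x.2.IsHomogeneous x.1 ∧ aeval Y x.2 ∈ 𝔞 ⊔ 𝔟}
  have hcomp : ∀ F : MvPolynomial (Fin d) k, aeval Y F ∈ 𝔞 ⊔ 𝔟 → ∀ e, aeval Y (homogeneousComponent e F) ∈ 𝔞 ⊔ 𝔟 := by
    intro F hF e
    rw [← whc_aeval hN F Y hY e]
    exact ha.sup hb _ hF _
  obtain ⟨i0, hi0⟩ : ∃ i : ι, i.1.2 ≠ 0 := by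
    obtain ⟨F, hF0, hF⟩ := hq0
    by_contra hcon
    push Not at hcon
    apply hF0
    rw [← sum_homogeneousComponent F]
    apply Finset.sum_eq_zero
    intro e _
    exact hcon ⟨(e, homogeneousComponent e F), homogeneousComponent_isHomogeneous e F, hcomp F hF e⟩
  have hcop1 : ∀ h : MvPolynomial (Fin d) k, Prime h → ∃ i : ι, ¬ h ∣ i.1.2 := by
    intro h hh
    obtain ⟨F, hF, hFh⟩ := hq1 h hh
    by_contra hcon
    push Not at hcon
    apply hFh
    rw [← sum_homogeneousComponent F]
    apply Finset.dvd_sum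
    intro e _
    exact hcon ⟨(e, homogeneousComponent e F), homogeneousComponent_isHomogeneous e F, hcomp F hF e⟩
  have hdec : ∀ i : ι, ∃ x y, x ∈ 𝔞 ∧ y ∈ 𝔟 ∧ IsWeightedHomogeneous ω x (N * i.1.1) ∧
      IsWeightedHomogeneous ω y (N * i.1.1) ∧ aeval Y i.1.2 = x + y := by
    intro i
    obtain ⟨x, hx, y, hy, hxy⟩ := Submodule.mem_sup.1 i.2.2
    refine ⟨weightedHomogeneousComponent ω (N * i.1.1) x, weightedHomogeneousComponent ω (N * i.1.1) y,
      ha x hx _, hb y hy _, weightedHomogeneousComponent_isWeightedHomogeneous _ _,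
      weightedHomogeneousComponent_isWeightedHomogeneous _ _, ?_⟩
    rw [← map_add, hxy]
    exact ((aeval_whom i.2.1 Y hY).weightedHomogeneousComponent_same).symm
  choose x y hx hy hxh hyh hxy using hdec
  let θ : Polynomial (MvPolynomial (Fin d) k) →+* Rees ω I :=
    (Thet N I Y).codRestrict (Rees ω I) (Thet_mem N I Y hY)
  letI : Algebra (Polynomial (MvPolynomial (Fin d) k)) (Rees ω I) := θ.toAlgebra
  have hθ : ∀ s, ((algebraMap (Polynomial (MvPolynomial (Fin d) k)) (Rees ω I) s : Rees ω I) :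
      Polynomial (MvPolynomial (Fin n) k ⧸ I)) = Thet N I Y s := fun s => rfl
  have hθX : algebraMap (Polynomial (MvPolynomial (Fin d) k)) (Rees ω I) Polynomial.X =
    ⟨Polynomial.X, X_mem_Rees⟩ := Subtype.ext (by rw [hθ, Thet_X])
  have hgen : ∀ r : Rees ω I, ∃ s : (Fin n → Fin l) → Polynomial (MvPolynomial (Fin d) k),
      (∀ b, WS N (r : Polynomial (MvPolynomial (Fin n) k ⧸ I)).natDegree (Finsupp.weight ω (bexp b)) (s b)) ∧
      r = ∑ b, s b • (⟨Phi ω I b, Phi_mem ω I b⟩ : Rees ω I) := by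
    intro r
    obtain ⟨s, h1, h2⟩ := GEN_Rees hN hY hl r.1 r.2
    refine ⟨s, h1, Subtype.ext ?_⟩
    rw [h2]
    rw [AddSubmonoidClass.coe_finsetSum]
    apply Finset.sum_congr rfl
    intro b _
    rw [Algebra.smul_def]
    rfl
  haveI : IsDomain (MvPolynomial (Fin n) k ⧸ I) := Ideal.Quotient.isDomain I
  haveI hfin : Module.Finite (Polynomial (MvPolynomial (Fin d) k)) (Rees ω I) := by
    refine ⟨⟨Finset.univ.image (fun b : Fin n → Fin l => (⟨Phi ω I b, Phi_mem ω I b⟩ : Rees ω I)), ?_⟩⟩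
    rw [eq_top_iff]
    intro r _
    obtain ⟨s, -, h⟩ := hgen r
    rw [h]
    refine sum_mem fun b _ => Submodule.smul_mem _ _ (Submodule.subset_span ?_)
    simp
  have hθinj : Function.Injective (algebraMap (Polynomial (MvPolynomial (Fin d) k)) (Rees ω I)) := by
    intro s s' hs
    exact Thet_inj N hN I Y hY hinj (congrArg Subtype.val hs)
  obtain ⟨φ, hφ⟩ := exists_phi hθinj
  have hbound : ∃ δ, ∀ b : Fin n → Fin l, WS N δ 0 (φ ⟨Phi ω I b, Phi_mem ω I b⟩) := by
    choose δ hδ using fun b : Fin n → Fin l => WS_exists (N := N) (φ ⟨Phi ω I b, Phi_mem ω I b⟩)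
    exact ⟨∑ b, δ b, fun b => (hδ b).mono (Finset.single_le_sum (fun _ _ => Nat.zero_le _) (Finset.mem_univ b)) le_rfl⟩
  obtain ⟨δ, hδ⟩ := hbound
  have hφdeg : ∀ r : Rees ω I, WS N ((r : Polynomial (MvPolynomial (Fin n) k ⧸ I)).natDegree + δ) 0 (φ r) := by
    intro r
    obtain ⟨s, h1, h2⟩ := hgen r
    have h3 : φ r = ∑ b, s b * φ ⟨Phi ω I b, Phi_mem ω I b⟩ := by
      conv_lhs => rw [h2, map_sum]
      simp only [map_smul, smul_eq_mul]
    rw [h3]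
    refine WS.sum _ _ fun b _ => ?_
    exact ((h1 b).mono le_rfl (Nat.zero_le _)).mul (hδ b)
  let a' : ι → Rees ω I := fun i => hom I (x i) _ (hxh i)
  let b' : ι → Rees ω I := fun i => hom I (y i) _ (hyh i)
  have hsum : ∀ i : ι, algebraMap (Polynomial (MvPolynomial (Fin d) k)) (Rees ω I) (Polynomial.C i.1.2) = a' i + b' i := by
    intro i
    apply Subtype.ext
    rw [hθ, Thet_homog N I Y _ _ i.2.1, hxy, map_add, map_add]
    rfl
  have hdv : ∀ i j : ι, algebraMap (Polynomial (MvPolynomial (Fin d) k)) (Rees ω I) Polynomial.X ∣ a' i * b' j := by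
    intro i j
    rw [hθX, hom_mul, hom_dvd]
    exact hab _ (hx i) _ (hy j)
  have hnd : ∀ m j, j ≤ m → ((a' i0 ^ j * b' i0 ^ (m - j) : Rees ω I) :
      Polynomial (MvPolynomial (Fin n) k ⧸ I)).natDegree ≤ m * (N * i0.1.1) := by
    intro m j hj
    rw [hom_pow, hom_pow, hom_mul]
    refine (Polynomial.natDegree_monomial_le _).trans ?_
    rw [← add_mul]
    exact Nat.mul_le_mul_right _ (by omega)
  let term : ℕ → ℕ → Rees ω I := fun n j => a' i0 ^ j * b' i0 ^ (2 * n - j) * ((2 * n).choose j : Rees ω I)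
  let α : ℕ → Rees ω I := fun n => ∑ j ∈ (Finset.range (2 * n + 1)).filter (fun j => n ≤ j), term n j
  let β : ℕ → Rees ω I := fun n => ∑ j ∈ (Finset.range (2 * n + 1)).filter (fun j => ¬ n ≤ j), term n j
  have hmain := core i0.1.2 (fun i : ι => i.1.2) (a' i0) (b' i0) a' b' hi0 hsum (hdv i0 i0) (fun i => hdv i0 i)
    (fun i => hdv i i0) ?_ α β ?_ ?_ ?_ φ hφ ?_
  · rcases hmain with h | h
    · left
      apply ha.le_of
      intro e f hf hfe
      obtain ⟨m, hm⟩ := h (hom I f e hfe) (by rw [hθX, hom_mul, hom_dvd]; exact hab _ hf _ (hy i0))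
      rw [hθX, hom_pow, hom_dvd] at hm
      exact ⟨m, hm⟩
    · right
      apply hb.le_of
      intro e f hf hfe
      obtain ⟨m, hm⟩ := h (hom I f e hfe) (by
        rw [hθX, hom_mul, hom_dvd, mul_comm]; exact hab _ (hx i0) _ hf)
      rw [hθX, hom_pow, hom_dvd] at hm
      exact ⟨m, hm⟩
  · intro m u hu
    have hz : i0.1.2 ^ m ≠ 0 := pow_ne_zero _ hi0
    generalize i0.1.2 ^ m = z at hu hz
    induction z using UniqueFactorizationMonoid.induction_on_prime generalizing u with
    | h₁ => exact absurd rfl hz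
    | h₂ z hzu => exact hzu.dvd
    | h₃ z h hz0 hh ih =>
      obtain ⟨i, hi⟩ := hcop1 h hh
      have h1 : h ∣ u := by
        rcases hh.dvd_or_dvd ((dvd_mul_right h z).trans (hu i)) with h2 | h2
        · exact absurd (hh.dvd_of_dvd_pow h2) hi
        · exact h2
      obtain ⟨u', rfl⟩ := h1
      apply mul_dvd_mul_left
      apply ih _ _ hz0
      intro i
      have := hu i
      rw [mul_left_comm] at this
      exact (mul_dvd_mul_iff_left hh.ne_zero).1 this
  · intro m
    rw [map_pow, map_pow, hsum, add_pow]
    exact (Finset.sum_filter_add_sum_filter_not _ _ _).symm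
  · intro m
    apply Finset.dvd_sum
    intro j hj
    rw [Finset.mem_filter] at hj
    exact Dvd.dvd.mul_right (Dvd.dvd.mul_right (pow_dvd_pow _ hj.2) _) _
  · intro m
    apply Finset.dvd_sum
    intro j hj
    rw [Finset.mem_filter] at hj
    exact Dvd.dvd.mul_right (Dvd.dvd.mul_left (pow_dvd_pow _ (by omega)) _) _
  · intro r
    refine ⟨(r : Polynomial (MvPolynomial (Fin n) k ⧸ I)).natDegree + δ, ?_⟩
    intro m j hj _ w hw
    by_contra hw0
    have hαdeg : ((α m : Rees ω I) : Polynomial (MvPolynomial (Fin n) k ⧸ I)).natDegree ≤ 2 * m * (N * i0.1.1) := by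
      change ((∑ j ∈ (Finset.range (2 * m + 1)).filter (fun j => m ≤ j), term m j : Rees ω I) :
        Polynomial (MvPolynomial (Fin n) k ⧸ I)).natDegree ≤ _
      rw [AddSubmonoidClass.coe_finsetSum]
      apply Polynomial.natDegree_sum_le_of_forall_le
      intro j hj
      rw [Finset.mem_filter, Finset.mem_range] at hj
      have h1 := hnd (2 * m) j (by omega)
      have h2 : ((term m j : Rees ω I) : Polynomial (MvPolynomial (Fin n) k ⧸ I)) =
        ((a' i0 ^ j * b' i0 ^ (2 * m - j) : Rees ω I) : Polynomial (MvPolynomial (Fin n) k ⧸ I)) *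
          (((2 * m).choose j : ℕ) : Polynomial (MvPolynomial (Fin n) k ⧸ I)) := by
        simp [term]
      rw [h2]
      refine (Polynomial.natDegree_mul_le).trans ?_
      rw [Polynomial.natDegree_natCast, add_zero]
      exact h1
    have hne : i0.1.2 ^ (2 * m) * w ≠ 0 := mul_ne_zero (pow_ne_zero _ hi0) hw0
    have htd : (i0.1.2 ^ (2 * m) * w).totalDegree = 2 * m * i0.1.1 + w.totalDegree := by
      rw [totalDegree_mul_of_isDomain (pow_ne_zero _ hi0) hw0,
        (i0.2.1.pow (2 * m)).totalDegree (pow_ne_zero _ hi0), mul_comm i0.1.1]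
    obtain ⟨v, hv, hv2⟩ := Finset.exists_mem_eq_sup (i0.1.2 ^ (2 * m) * w).support (by simpa using hne)
      (fun s => s.sum fun _ e => e)
    have hv3 : v.degree = 2 * m * i0.1.1 + w.totalDegree := by
      rw [← htd, totalDegree, hv2]; rfl
    rw [mem_support_iff, hw] at hv
    have h5 := hφdeg (r * α m) j v hv
    have h6 : ((r * α m : Rees ω I) : Polynomial (MvPolynomial (Fin n) k ⧸ I)).natDegree ≤
        (r : Polynomial (MvPolynomial (Fin n) k ⧸ I)).natDegree + 2 * m * (N * i0.1.1) :=
      (Polynomial.natDegree_mul_le).trans (by omega)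
    rw [hv3, mul_add] at h5
    have h7 : N * (2 * m * i0.1.1) = 2 * m * (N * i0.1.1) := by ring
    rw [h7] at h5
    omega

end part5


section part6
open MvPolynomial

theorem fin_psi {k : Type} [Field k] {n d : ℕ} {ω : Fin n → ℕ} {N l : ℕ} (hN : 0 < N)
    {J 𝔠 : Ideal (MvPolynomial (Fin n) k)} (hJ : HomogI ω J) (hJc : J ≤ 𝔠)
    {Y : Fin d → MvPolynomial (Fin n) k} (hY : ∀ i, IsWeightedHomogeneous ω (Y i) N)
    (hl : ∀ j, X j ^ l ∈ J ⊔ Ideal.span (Set.range Y)) :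
    ((Ideal.Quotient.mk 𝔠).comp (aeval Y : MvPolynomial (Fin d) k →ₐ[k] _).toRingHom).IsIntegral := by
  apply RingHom.Finite.to_isIntegral
  set ψ := ((Ideal.Quotient.mk 𝔠).comp (aeval Y : MvPolynomial (Fin d) k →ₐ[k] _).toRingHom) with hψ
  letI alg := ψ.toAlgebra
  letI : Module (MvPolynomial (Fin d) k) (MvPolynomial (Fin n) k ⧸ 𝔠) := alg.toModule
  have hsm : ∀ (a : MvPolynomial (Fin d) k) (x : MvPolynomial (Fin n) k ⧸ 𝔠),
    a • x = Ideal.Quotient.mk 𝔠 (aeval Y a) * x := fun a x => rfl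
  set M : Submodule (MvPolynomial (Fin d) k) (MvPolynomial (Fin n) k ⧸ 𝔠) :=
    Submodule.span _ (Set.range fun b : Fin n → Fin l => Ideal.Quotient.mk 𝔠 (monomial (bexp b) 1)) with hM
  have hom : ∀ i, ∀ f, IsWeightedHomogeneous ω f i → Ideal.Quotient.mk 𝔠 f ∈ M := by
    intro i
    induction i using Nat.strong_induction_on with
    | _ i ih =>
    have key : ∀ u, Finsupp.weight ω u = i → Ideal.Quotient.mk 𝔠 (monomial u 1) ∈ M := by
      intro u hu
      by_cases hul : ∀ j, u j < l
      · have hb : bexp (fun j => (⟨u j, hul j⟩ : Fin l)) = u := by ext j; simp [bexp]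
        rw [← hb]
        exact Submodule.subset_span ⟨_, rfl⟩
      · push Not at hul
        obtain ⟨j, hj⟩ := hul
        obtain ⟨c, hc, z, hz, hcz⟩ := Submodule.mem_sup.1 (hl j)
        obtain ⟨h, rfl⟩ := (Ideal.mem_span_range_iff_exists_fun).1 hz
        set g : MvPolynomial (Fin n) k := monomial (u - Finsupp.single j l) 1 with hg
        have hf : monomial u (1 : k) = X j ^ l * g := by
          rw [hg, X_pow_eq_monomial, monomial_mul, one_mul, add_tsub_cancel_of_le]
          simpa using hj
        have hf2 : monomial u (1 : k) = weightedHomogeneousComponent ω i (c * g) +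
            ∑ r, weightedHomogeneousComponent ω i (Y r * (h r * g)) := by
          rw [← map_sum, ← map_add]
          rw [← (isWeightedHomogeneous_monomial ω u (1 : k) hu).weightedHomogeneousComponent_same]
          congr 1
          rw [hf, ← hcz, add_mul, Finset.sum_mul]
          congr 1
          apply Finset.sum_congr rfl
          intro r _; ring
        rw [hf2, map_add, map_sum]
        apply add_mem
        · rw [Ideal.Quotient.eq_zero_iff_mem.2 (hJc (hJ _ (J.mul_mem_right g hc) i))]
          exact zero_mem _
        · apply sum_mem
          intro r _
          rw [whc_homog_mul ω (Y r) N (hY r)]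
          split_ifs with hNi
          · have := M.smul_mem (X r) (ih (i - N) (by omega) _
              (weightedHomogeneousComponent_isWeightedHomogeneous (i - N) (h r * g)))
            rw [hsm, aeval_X] at this
            rwa [map_mul]
          · simp
    intro f hf
    rw [f.as_sum, map_sum]
    apply sum_mem
    intro u hu
    have := M.smul_mem (C (coeff u f)) (key u (hf (mem_support_iff.1 hu)))
    rw [hsm, ← map_mul, aeval_C, algebraMap_eq, C_mul_monomial, mul_one] at this
    exact this
  have top : M = ⊤ := by
    rw [eq_top_iff]
    rintro x -
    obtain ⟨f, rfl⟩ := Ideal.Quotient.mk_surjective x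
    rw [sum_whc ω f _ (mem_wle_wDeg ω f), map_sum]
    exact sum_mem fun e _ => hom e _ (weightedHomogeneousComponent_isWeightedHomogeneous e f)
  show Module.Finite _ _
  refine ⟨?_⟩
  rw [← top]
  exact Submodule.fg_span (Set.finite_range _)

theorem dim_le_of_integral {A B : Type} [CommRing A] [CommRing B] (ψ : A →+* B) (h : ψ.IsIntegral) :
    ringKrullDim B ≤ ringKrullDim A := by
  letI := ψ.toAlgebra
  haveI : Algebra.IsIntegral A B := ⟨h⟩
  apply Order.krullDim_le_of_strictMono (PrimeSpectrum.comap ψ)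
  intro p q hpq
  exact Ideal.IsIntegral.comap_lt_comap (R := A) (I := p.asIdeal) (J := q.asIdeal) hpq

theorem le_dim_of_integral {A B : Type} [CommRing A] [CommRing B] (ψ : A →+* B) (h : ψ.IsIntegral)
    (p : Ideal A) (hp : RingHom.ker ψ ≤ p) :
    ringKrullDim (A ⧸ p) ≤ ringKrullDim B := by
  letI := ψ.toAlgebra
  haveI : Algebra.IsIntegral A B := ⟨h⟩
  haveI : Algebra.HasGoingUp A B := Algebra.HasGoingUp.of_isIntegral
  apply iSup_le
  intro s
  have hf : StrictMono (PrimeSpectrum.comap (Ideal.Quotient.mk p)) := by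
    apply Monotone.strictMono_of_injective
    · intro a b hab; exact Ideal.comap_mono hab
    · exact PrimeSpectrum.comap_injective_of_surjective _ Ideal.Quotient.mk_surjective
  set t := s.map _ hf with ht
  have hk : RingHom.ker (algebraMap A B) ≤ (RelSeries.head t).asIdeal := by
    refine hp.trans ?_
    have : (RelSeries.head t) = PrimeSpectrum.comap (Ideal.Quotient.mk p) (RelSeries.head s) := rfl
    rw [this]
    intro x hx
    show Ideal.Quotient.mk p x ∈ (RelSeries.head s).asIdeal
    rw [Ideal.Quotient.eq_zero_iff_mem.2 hx]; exact zero_mem _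
  obtain ⟨Q, -, hQ, hQ2⟩ := Ideal.exists_ideal_over_prime_of_isIntegral (R := A) (S := B) _ ⊥ hk
  haveI : Q.LiesOver (RelSeries.head t).asIdeal := ⟨hQ2.symm⟩
  obtain ⟨L, hL, -⟩ := Ideal.exists_ltSeries_of_hasGoingUp t Q
  have : s.length = L.length := by rw [hL]; rfl
  rw [this]
  exact Order.LTSeries.length_le_krullDim L

theorem height_max_aux {R : Type} [CommRing R] [IsNoetherianRing R] [IsJacobsonRing R]
    (M : Ideal (Polynomial R)) [M.IsMaximal] :
    ∃ p : Ideal R, p.IsMaximal ∧ M.height = p.height + 1 := by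
  haveI : M.LiesOver (M.comap Polynomial.C) := ⟨rfl⟩
  exact ⟨M.comap Polynomial.C, Polynomial.isMaximal_comap_C_of_isJacobsonRing M,
    Polynomial.height_eq_height_add_one _ M⟩

theorem height_max {k : Type} [Field k] (d : ℕ) (m : Ideal (MvPolynomial (Fin d) k)) (hm : m.IsMaximal) :
    m.height = d := by
  induction d with
  | zero =>
    have h0 := Ideal.height_le_ringKrullDim_of_ne_top hm.ne_top
    rw [MvPolynomial.ringKrullDim_of_isNoetherianRing, ringKrullDim_eq_zero_of_field] at h0
    simp at h0
    simpa using h0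
  | succ d ih =>
    set e := (finSuccEquiv k d).toRingEquiv
    have hM : (m.comap e.symm).IsMaximal := Ideal.comap_isMaximal_of_equiv e.symm
    have := RingEquiv.height_comap e.symm m
    rw [← this]
    set M : Ideal (Polynomial (MvPolynomial (Fin d) k)) := m.comap e.symm
    haveI : M.IsMaximal := hM
    obtain ⟨p, hp, hpM⟩ := height_max_aux M
    rw [hpM, ih p hp]
    simp

theorem le_dim_quot {k : Type} [Field k] (d : ℕ) (h : MvPolynomial (Fin d) k) (hh : ¬ IsUnit h) :
    ((d : ℕ) : WithBot ℕ∞) ≤ ringKrullDim (MvPolynomial (Fin d) k ⧸ Ideal.span {h}) + 1 := by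
  obtain ⟨m, hm, hhm⟩ := exists_max_ideal_of_mem_nonunits hh
  have := hm.isPrime
  have h1 := Ideal.height_le_ringKrullDim_quotient_add_one hhm
  rw [height_max d m hm] at h1
  simpa using h1

end part6

open TopologicalSpace
section part7

theorem topDim_bdd {T : Type*} [TopologicalSpace T] {d : ℕ} (h : topologicalKrullDim T ≤ (d : WithBot ℕ∞)) :
    ∀ x ∈ ({-1} ∪ {d : ℤ | ∃ n : ℕ, d = (n : ℤ) ∧
      ∃ c : Fin (n + 1) → IrreducibleCloseds T, StrictMono c}), x ≤ (d : ℤ) := by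
  rintro x (rfl | ⟨n, rfl, c, hc⟩)
  · omega
  · have h1 := Order.LTSeries.length_le_krullDim (LTSeries.mk n c hc)
    have h2 : ((n : ℕ) : WithBot ℕ∞) ≤ (d : WithBot ℕ∞) := h1.trans h
    have h3 : n ≤ d := by exact_mod_cast h2
    exact_mod_cast h3

theorem topDim_le {T : Type*} [TopologicalSpace T] {d : ℕ} (h : topologicalKrullDim T ≤ (d : WithBot ℕ∞)) :
    topDim T ≤ d :=
  csSup_le ⟨-1, Or.inl rfl⟩ (topDim_bdd h)

theorem neg_one_le_topDim {T : Type*} [TopologicalSpace T] {d : ℕ}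
    (h : topologicalKrullDim T ≤ (d : WithBot ℕ∞)) : -1 ≤ topDim T :=
  le_csSup ⟨d, topDim_bdd h⟩ (Or.inl rfl)

theorem le_topDim {T : Type*} [TopologicalSpace T] {d m : ℕ}
    (h : topologicalKrullDim T ≤ (d : WithBot ℕ∞)) (hm : (m : WithBot ℕ∞) ≤ topologicalKrullDim T) :
    (m : ℤ) ≤ topDim T := by
  obtain ⟨s, hs⟩ := Order.le_krullDim_iff.1 hm
  subst hs
  exact le_csSup ⟨d, topDim_bdd h⟩ (Or.inr ⟨s.length, rfl, s.toFun, s.strictMono⟩)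

theorem topDim_of_empty {T : Type*} [TopologicalSpace T] [IsEmpty T] : topDim T = -1 := by
  have : ({-1} ∪ {d : ℤ | ∃ n : ℕ, d = (n : ℤ) ∧
      ∃ c : Fin (n + 1) → IrreducibleCloseds T, StrictMono c}) = {-1} := by
    apply Set.union_eq_self_of_subset_right
    rintro x ⟨n, rfl, c, hc⟩
    obtain ⟨y, hy⟩ := (c 0).isIrreducible.nonempty
    exact isEmptyElim y
  rw [topDim, this, csSup_singleton]

end part7

section part8
open MvPolynomial

theorem homogI_minprime {k : Type} [Field k] {n : ℕ} {ω : Fin n → ℕ} {J p : Ideal (MvPolynomial (Fin n) k)}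
    (hJ : HomogI ω J) (hp : p ∈ J.minimalPrimes) : HomogI ω p := by
  rw [← homogI_iff] at hJ ⊢
  letI := weightedGradedAlgebra k ω
  have h1 : p.IsPrime := hp.1.1
  have h2 := Ideal.IsPrime.homogeneousCore (𝒜 := weightedHomogeneousSubmodule k ω) h1
  have h3 : J ≤ (p.homogeneousCore (weightedHomogeneousSubmodule k ω)).toIdeal := by
    have h4 := Ideal.homogeneousCore_mono (weightedHomogeneousSubmodule k ω) hp.1.2
    have h5 := Ideal.IsHomogeneous.toIdeal_homogeneousCore_eq_self (𝒜 := weightedHomogeneousSubmodule k ω) hJ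
    rw [← h5]; exact h4
  have h6 := hp.2 ⟨h2, h3⟩ (Ideal.toIdeal_homogeneousCore_le _ _)
  have h7 := le_antisymm h6 (Ideal.toIdeal_homogeneousCore_le _ _)
  have h8 : Ideal.IsHomogeneous (weightedHomogeneousSubmodule k ω) p := by
    rw [h7]; exact HomogeneousIdeal.isHomogeneous _
  exact h8

theorem homogI_pow {k : Type} [Field k] {n : ℕ} {ω : Fin n → ℕ} {J : Ideal (MvPolynomial (Fin n) k)}
    (hJ : HomogI ω J) (m : ℕ) : HomogI ω (J ^ m) := by
  rw [← homogI_iff] at hJ ⊢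
  letI := weightedGradedAlgebra k ω
  induction m with
  | zero => rw [pow_zero, Ideal.one_eq_top]; exact Ideal.IsHomogeneous.top (weightedHomogeneousSubmodule k ω)
  | succ m ih => rw [pow_succ]; exact Ideal.IsHomogeneous.mul ih hJ

theorem homogI_sInf {k : Type} [Field k] {n : ℕ} {ω : Fin n → ℕ} {S : Set (Ideal (MvPolynomial (Fin n) k))}
    (hS : ∀ J ∈ S, HomogI ω J) : HomogI ω (sInf S) := by
  intro f hf l
  rw [Ideal.mem_sInf] at hf ⊢
  exact fun {J} hJ => hS J hJ f (hf hJ) l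

theorem split_ideals {k : Type} [Field k] {n : ℕ} {ω : Fin n → ℕ} {J a0 b0 : Ideal (MvPolynomial (Fin n) k)}
    (hJ : HomogI ω J) (h : ∀ p : Ideal (MvPolynomial (Fin n) k), p.IsPrime → J ≤ p → a0 ≤ p ∨ b0 ≤ p) :
    ∃ a b, HomogI ω a ∧ HomogI ω b ∧ J ≤ a ∧ a0 ≤ a.radical ∧ b0 ≤ b.radical ∧
      ∀ x ∈ a, ∀ y ∈ b, x * y ∈ J := by
  set a1 := sInf {p | p ∈ J.minimalPrimes ∧ a0 ≤ p} with ha1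
  set b1 := sInf {p | p ∈ J.minimalPrimes ∧ b0 ≤ p} with hb1
  have ha : HomogI ω a1 := homogI_sInf fun p hp => homogI_minprime hJ hp.1
  have hb : HomogI ω b1 := homogI_sInf fun p hp => homogI_minprime hJ hp.1
  have hr : a1 * b1 ≤ J.radical := by
    rw [← Ideal.sInf_minimalPrimes]
    refine le_sInf fun p hp => ?_
    rcases h p hp.1.1 hp.1.2 with h1 | h1
    · exact Ideal.mul_le_left.trans (sInf_le ⟨hp, h1⟩)
    · exact Ideal.mul_le_right.trans (sInf_le ⟨hp, h1⟩)
  obtain ⟨m, hm⟩ := Ideal.exists_pow_le_of_le_radical_of_fg hr (IsNoetherian.noetherian _)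
  refine ⟨J ⊔ a1 ^ m, J ⊔ b1 ^ m, hJ.sup (homogI_pow ha m), hJ.sup (homogI_pow hb m), le_sup_left,
    ?_, ?_, ?_⟩
  · intro x hx
    exact ⟨m, Ideal.mem_sup_right (Ideal.pow_mem_pow ((le_sInf fun p hp => hp.2 : a0 ≤ a1) hx) m)⟩
  · intro x hx
    exact ⟨m, Ideal.mem_sup_right (Ideal.pow_mem_pow ((le_sInf fun p hp => hp.2 : b0 ≤ b1) hx) m)⟩
  · intro x hx y hy
    obtain ⟨j, hj, x, hx2, rfl⟩ := Submodule.mem_sup.1 hx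
    obtain ⟨j', hj', y, hy2, rfl⟩ := Submodule.mem_sup.1 hy
    rw [add_mul, mul_add x]
    refine J.add_mem (J.mul_mem_right _ hj) (J.add_mem (J.mul_mem_left _ hj') (hm ?_))
    rw [mul_pow]
    exact Ideal.mul_mem_mul hx2 hy2

theorem le_dim_c {k : Type} [Field k] {n d : ℕ} {ω : Fin n → ℕ} {N l : ℕ} (hN : 0 < N)
    {J 𝔠 : Ideal (MvPolynomial (Fin n) k)} (hJ : HomogI ω J) (hJc : J ≤ 𝔠)
    {Y : Fin d → MvPolynomial (Fin n) k} (hY : ∀ i, IsWeightedHomogeneous ω (Y i) N)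
    (hl : ∀ j, X j ^ l ∈ J ⊔ Ideal.span (Set.range Y))
    (h : MvPolynomial (Fin d) k) (hh : ¬ IsUnit h) (hc : ∀ F, aeval Y F ∈ 𝔠 → h ∣ F) :
    ((d : ℕ) : WithBot ℕ∞) ≤ ringKrullDim (MvPolynomial (Fin n) k ⧸ 𝔠) + 1 := by
  refine (le_dim_quot d h hh).trans ?_
  gcongr
  refine le_dim_of_integral _ (fin_psi hN hJ hJc hY hl) _ ?_
  intro F hF
  rw [Ideal.mem_span_singleton]
  exact hc F (Ideal.Quotient.eq_zero_iff_mem.1 hF)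

theorem dim_le_J {k : Type} [Field k] {n d : ℕ} {ω : Fin n → ℕ} {N l : ℕ} (hN : 0 < N)
    {J : Ideal (MvPolynomial (Fin n) k)} (hJ : HomogI ω J)
    {Y : Fin d → MvPolynomial (Fin n) k} (hY : ∀ i, IsWeightedHomogeneous ω (Y i) N)
    (hl : ∀ j, X j ^ l ∈ J ⊔ Ideal.span (Set.range Y)) :
    ringKrullDim (MvPolynomial (Fin n) k ⧸ J) ≤ (d : WithBot ℕ∞) := by
  refine (dim_le_of_integral _ (fin_psi hN hJ le_rfl hY hl)).trans ?_
  rw [MvPolynomial.ringKrullDim_of_isNoetherianRing, ringKrullDim_eq_zero_of_field]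
  simp

theorem topo_dim {R : Type} [CommRing R] {J c : Ideal R} (hJc : J ≤ c) (Z : Set (PrimeSpectrum (R ⧸ J)))
    (hZ : ∀ x : PrimeSpectrum (R ⧸ J), c ≤ x.asIdeal.comap (Ideal.Quotient.mk J) → x ∈ Z) :
    ringKrullDim (R ⧸ c) ≤ topologicalKrullDim Z := by
  rw [← PrimeSpectrum.topologicalKrullDim_eq_ringKrullDim]
  have h1 := PrimeSpectrum.isClosedEmbedding_comap_of_surjective (R ⧸ c) (Ideal.Quotient.factor hJc)
    (Ideal.Quotient.factor_surjective hJc)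
  have h2 : ∀ x, PrimeSpectrum.comap (Ideal.Quotient.factor hJc) x ∈ Z := by
    intro x
    apply hZ
    intro y hy
    show Ideal.Quotient.factor hJc (Ideal.Quotient.mk J y) ∈ x.asIdeal
    rw [Ideal.Quotient.factor_mk, Ideal.Quotient.eq_zero_iff_mem.2 hy]
    exact zero_mem _
  exact (h1.isInducing.codRestrict h2).topologicalKrullDim_le

theorem split_topo {R : Type} [CommRing R] {J : Ideal R} (Z : Set (PrimeSpectrum (R ⧸ J)))
    (hZ : IsClosed Z) (hne : Zᶜ.Nonempty) (hc : ¬ ConnectedSpace ↥(Zᶜ)) :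
    ∃ a0 b0 : Ideal R, (∀ p : Ideal R, p.IsPrime → J ≤ p → a0 ≤ p ∨ b0 ≤ p) ∧
      (∃ p : Ideal R, p.IsPrime ∧ J ≤ p ∧ ¬ a0 ≤ p) ∧ (∃ p : Ideal R, p.IsPrime ∧ J ≤ p ∧ ¬ b0 ≤ p) ∧
      ∀ x : PrimeSpectrum (R ⧸ J), a0 ≤ x.asIdeal.comap (Ideal.Quotient.mk J) →
        b0 ≤ x.asIdeal.comap (Ideal.Quotient.mk J) → x ∈ Z := by
  have hp : ¬ IsPreconnected (Zᶜ) := by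
    intro hp
    exact hc (isConnected_iff_connectedSpace.1 ⟨hne, hp⟩)
  rw [isPreconnected_closed_iff] at hp
  push Not at hp
  obtain ⟨t, t', ht, ht', hcov, ⟨x, hx⟩, ⟨x', hx'⟩, hemp⟩ := hp
  have key : ∀ A : Set (PrimeSpectrum (R ⧸ J)), IsClosed A → ∀ x : PrimeSpectrum (R ⧸ J),
      (PrimeSpectrum.vanishingIdeal A).comap (Ideal.Quotient.mk J) ≤ x.asIdeal.comap (Ideal.Quotient.mk J) ↔ x ∈ A := by
    intro A hA x
    rw [Ideal.comap_le_comap_iff_of_surjective _ Ideal.Quotient.mk_surjective]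
    conv_rhs => rw [← hA.closure_eq, ← PrimeSpectrum.zeroLocus_vanishingIdeal_eq_closure]
    rfl
  have hle : ∀ x : PrimeSpectrum (R ⧸ J), J ≤ x.asIdeal.comap (Ideal.Quotient.mk J) := by
    intro x y hy
    rw [Ideal.mem_comap, Ideal.Quotient.eq_zero_iff_mem.2 hy]
    exact zero_mem _
  have hemp' : ∀ y, y ∉ Z → y ∈ t → y ∈ t' → False := by
    intro y h1 h2 h3
    have : y ∈ Zᶜ ∩ (t ∩ t') := ⟨h1, h2, h3⟩
    rw [hemp] at this; exact this
  refine ⟨(PrimeSpectrum.vanishingIdeal (Z ∪ t)).comap (Ideal.Quotient.mk J),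
    (PrimeSpectrum.vanishingIdeal (Z ∪ t')).comap (Ideal.Quotient.mk J), ?_, ?_, ?_, ?_⟩
  · intro p hp hJp
    haveI := hp
    have hmk : (p.map (Ideal.Quotient.mk J)).IsPrime :=
      Ideal.map_isPrime_of_surjective Ideal.Quotient.mk_surjective (by rwa [Ideal.mk_ker])
    have h1 : (p.map (Ideal.Quotient.mk J)).comap (Ideal.Quotient.mk J) = p := by
      rw [Ideal.comap_map_mk hJp]
    set y : PrimeSpectrum (R ⧸ J) := ⟨_, hmk⟩ with hy
    have h2 : y.asIdeal.comap (Ideal.Quotient.mk J) = p := h1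
    rw [← h2, key _ (hZ.union ht), key _ (hZ.union ht')]
    by_cases hyZ : y ∈ Z
    · exact Or.inl (Or.inl hyZ)
    · rcases hcov hyZ with h3 | h3
      · exact Or.inl (Or.inr h3)
      · exact Or.inr (Or.inr h3)
  · refine ⟨_, inferInstance, hle x', ?_⟩
    rw [key _ (hZ.union ht)]
    rintro (h | h)
    · exact hx'.1 h
    · exact hemp' x' hx'.1 h hx'.2
  · refine ⟨_, inferInstance, hle x, ?_⟩
    rw [key _ (hZ.union ht')]
    rintro (h | h)
    · exact hx.1 h
    · exact hemp' x hx.1 hx.2 h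
  · intro y h1 h2
    rw [key _ (hZ.union ht)] at h1
    rw [key _ (hZ.union ht')] at h2
    by_contra hy
    exact hemp' y hy (h1.resolve_left hy) (h2.resolve_left hy)

end part8


open TopologicalSpace
section part9
open MvPolynomial

theorem main_Z {k : Type} [Field k] {n d : ℕ} {ω : Fin n → ℕ} {N l : ℕ} (hN : 0 < N)
    {I : Ideal (MvPolynomial (Fin n) k)} (hI : I.IsPrime)
    {Y : Fin d → MvPolynomial (Fin n) k} (hY : ∀ i, IsWeightedHomogeneous ω (Y i) N)
    (hl : ∀ j, X j ^ l ∈ initialIdeal ω I ⊔ Ideal.span (Set.range Y))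
    (hinj : ∀ F : MvPolynomial (Fin d) k, aeval Y F ∈ initialIdeal ω I → F = 0)
    (Z : Set (PrimeSpectrum (MvPolynomial (Fin n) k ⧸ initialIdeal ω I)))
    (hZ : IsClosed Z) (hc : ¬ ConnectedSpace ↥(Zᶜ)) : 
    ((d : ℕ) : WithBot ℕ∞) ≤ topologicalKrullDim Z + 1 := by
  have hJ := (homogI_iff ω _).1 (initialIdeal_homog ω I)
  suffices H : ∃ c : Ideal (MvPolynomial (Fin n) k), (initialIdeal ω I) ≤ c ∧
      (∃ h : MvPolynomial (Fin d) k, ¬ IsUnit h ∧ ∀ F, aeval Y F ∈ c → h ∣ F) ∧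
      ∀ x : PrimeSpectrum (MvPolynomial (Fin n) k ⧸ (initialIdeal ω I)), c ≤ x.asIdeal.comap (Ideal.Quotient.mk (initialIdeal ω I)) → x ∈ Z by
    obtain ⟨c, hJc, ⟨h, hh, hF⟩, hx⟩ := H
    refine (le_dim_c hN hJ hJc hY hl h hh hF).trans ?_
    gcongr
    exact topo_dim hJc Z hx
  by_cases hne : Zᶜ.Nonempty
  · obtain ⟨a0, b0, h1, ⟨p, hp, hJp, hap⟩, ⟨q, hq, hJq, hbq⟩, hx⟩ := split_topo Z hZ hne hc
    obtain ⟨a, b, ha, hb, hJa, ha0, hb0, hab⟩ := split_ideals hJ h1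
    refine ⟨a ⊔ b, hJa.trans le_sup_left, ?_, ?_⟩
    · by_contra hcon
      push Not at hcon
      have hq0 : ∃ F : MvPolynomial (Fin d) k, F ≠ 0 ∧ aeval Y F ∈ a ⊔ b := by
        obtain ⟨F, h1, h2⟩ := hcon 0 not_isUnit_zero
        exact ⟨F, fun h => h2 (by rw [h]), h1⟩
      rcases conn_alg hN hI hY hl hinj ha hb hab hq0 (fun h hh => hcon h hh.not_isUnit) with h | h
      · exact hap (ha0.trans ((Ideal.radical_le_radical_iff.2 h).trans (hp.radical_le_iff.2 hJp)))
      · exact hbq (hb0.trans ((Ideal.radical_le_radical_iff.2 h).trans (hq.radical_le_iff.2 hJq)))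
    · intro x hcx
      have hpr : (x.asIdeal.comap (Ideal.Quotient.mk (initialIdeal ω I))).IsPrime := inferInstance
      exact hx x (ha0.trans (hpr.radical_le_iff.2 (le_sup_left.trans hcx)))
        (hb0.trans (hpr.radical_le_iff.2 (le_sup_right.trans hcx)))
  · refine ⟨(initialIdeal ω I), le_rfl, ⟨0, not_isUnit_zero, fun F hF => by rw [hinj F hF]⟩, fun x _ => ?_⟩
    by_contra hx
    exact hne ⟨x, hx⟩

end part9

theorem stmt_2 {k : Type} [Field k] {n : ℕ} (I : Ideal (MvPolynomial (Fin n) k))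
    (hI : I.IsPrime) (ω : Fin n → ℕ) (hω : ∀ i, 0 < ω i) :
    connDim (PrimeSpectrum (MvPolynomial (Fin n) k ⧸ initialIdeal ω I)) ≥
      topDim (PrimeSpectrum (MvPolynomial (Fin n) k ⧸ initialIdeal ω I)) - 1 := by
  have hnonempty : {d : ℤ | ∃ Z : Set (PrimeSpectrum (MvPolynomial (Fin n) k ⧸ initialIdeal ω I)),
      IsClosed Z ∧ ¬ ConnectedSpace ↥(Zᶜ) ∧ d = topDim ↥Z}.Nonempty := by
    refine ⟨_, Set.univ, isClosed_univ, ?_, rfl⟩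
    intro h
    obtain ⟨x, hx⟩ := h.toNonempty
    exact hx trivial
  refine le_csInf hnonempty ?_
  rintro _ ⟨Z, hZ, hc, rfl⟩
  by_cases hJ1 : initialIdeal ω I = ⊤
  · haveI : Subsingleton (MvPolynomial (Fin n) k ⧸ initialIdeal ω I) :=
      Ideal.Quotient.subsingleton_iff.2 hJ1
    haveI : IsEmpty (PrimeSpectrum (MvPolynomial (Fin n) k ⧸ initialIdeal ω I)) := inferInstance
    rw [topDim_of_empty, topDim_of_empty]
    norm_num
  · obtain ⟨d, N, hN, Y, hY, hrad, hinj⟩ := noether hω ((homogI_iff ω _).1 (initialIdeal_homog ω I)) hJ1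
    choose e he using hrad
    have hl : ∀ j, MvPolynomial.X j ^ (∑ j, e j) ∈ initialIdeal ω I ⊔ Ideal.span (Set.range Y) :=
      fun j => Ideal.pow_mem_of_pow_mem _ (he j) (Finset.single_le_sum (fun _ _ => Nat.zero_le _) (Finset.mem_univ j))
    have hup := dim_le_J hN ((homogI_iff ω _).1 (initialIdeal_homog ω I)) hY hl
    rw [← PrimeSpectrum.topologicalKrullDim_eq_ringKrullDim] at hup
    have hZup := (topologicalKrullDim_subspace_le _ Z).trans hup
    have h1 := topDim_le hup
    have h2 := main_Z hN hI hY hl hinj Z hZ hc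
    suffices (d : ℤ) - 1 ≤ topDim ↥Z by linarith
    cases d with
    | zero => simpa using neg_one_le_topDim hZup
    | succ m =>
      have h3 : ((m : ℕ) : WithBot ℕ∞) ≤ topologicalKrullDim Z := by
        generalize topologicalKrullDim Z = t at h2
        push_cast at h2
        exact ENat.WithBot.add_le_add_one_right_iff.1 h2
      have := le_topDim hZup h3
      push_cast; linarith
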